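/- arXiv:2510.01950 — 4 statements merged into one kernel-verified Lean document; each statement's English description precedes it below -/
import Mathlib

section
/- Let n ≥ 1 be an integer, ρ > 0, and x₁,…,xₙ ∈ (0,1). Let K̂ be the n×n real symmetric matrix with entries K̂_{ij} := 𝒦(x_i,x_j), and let ĉ(ρ) denote its smallest eigenvalue (so that K̂ − ĉ(ρ)·I is positive semidefinite). Then ĉ(ρ) ≥ min over i = 1,…,n of [ (8πρ)^{−1/2} · Σ_{k∈ℤ} (exp(−k²/(2ρ)) − exp(−(k + x_i)²/(2ρ))) − (8πρ)^{−1/2} · Σ_{j≠i} | Σ_{k∈ℤ} (exp(−(2k + x_j − x_i)²/(8ρ)) − exp(−(2k + x_j + x_i)²/(8ρ))) | ]. -/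
open Real

/-- The kernel ρ̃(x,y) := (4πρ)^{-1/2} · Σ_{n∈ℤ} [exp(−(2n+y−x)²/(4ρ)) − exp(−(2n+y+x)²/(4ρ))]. -/
noncomputable def rhoTilde (ρ x y : ℝ) : ℝ :=
  (Real.sqrt (4 * π * ρ))⁻¹ *
    ∑' n : ℤ, (Real.exp (-(2 * (n : ℝ) + y - x) ^ 2 / (4 * ρ)) -
      Real.exp (-(2 * (n : ℝ) + y + x) ^ 2 / (4 * ρ)))

/-- The covariance kernel 𝒦(x,y) := ∫₀¹ ρ̃(x,z)·ρ̃(z,y) dz. -/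
noncomputable def covK (ρ x y : ℝ) : ℝ := ∫ z in (0 : ℝ)..1, rhoTilde ρ x z * rhoTilde ρ z y

open MeasureTheory

/-- The `2`-periodization of the Gaussian `u ↦ exp (-u² / c)`. -/
noncomputable def periodizedGaussian (c u : ℝ) : ℝ :=
  ∑' n : ℤ, Real.exp (-(2 * (n : ℝ) + u) ^ 2 / c)

theorem summable_exp_neg_mul_int_sq {a : ℝ} (ha : 0 < a) :
    Summable fun n : ℤ => Real.exp (-a * (n : ℝ) ^ 2) := by
  have key : Summable fun n : ℕ => Real.exp (-a * (n : ℝ) ^ 2) := by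
    have h := Real.summable_pow_mul_exp_neg_nat_mul 0 ha
    refine Summable.of_nonneg_of_le (fun n => (Real.exp_pos _).le) (fun n => ?_) h
    rw [pow_zero, one_mul]
    refine Real.exp_le_exp.mpr ?_
    have h1 : (n : ℝ) ≤ (n : ℝ) ^ 2 := by exact_mod_cast Nat.le_self_pow two_ne_zero n
    nlinarith
  exact Summable.of_nat_of_neg (by simpa using key) (by simpa using key)

theorem exp_neg_shift_sq_le {c R u : ℝ} (hc : 0 < c) (hu : |u| ≤ R) (n : ℤ) :
    Real.exp (-(2 * (n : ℝ) + u) ^ 2 / c) ≤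
      Real.exp (R ^ 2 / c) * Real.exp (-(2 / c) * (n : ℝ) ^ 2) := by
  rw [← Real.exp_add]
  refine Real.exp_le_exp.mpr ?_
  have h1 : u ^ 2 ≤ R ^ 2 := sq_le_sq' (abs_le.mp hu).1 (abs_le.mp hu).2
  have h2 : R ^ 2 / c + -(2 / c) * (n : ℝ) ^ 2 = (R ^ 2 - 2 * (n : ℝ) ^ 2) / c := by ring
  rw [h2]
  gcongr
  nlinarith [sq_nonneg ((n : ℝ) + u)]

theorem summable_exp_neg_shift_sq {c : ℝ} (hc : 0 < c) (u : ℝ) :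
    Summable fun n : ℤ => Real.exp (-(2 * (n : ℝ) + u) ^ 2 / c) :=
  Summable.of_nonneg_of_le (fun _ => (Real.exp_pos _).le)
    (fun n => exp_neg_shift_sq_le hc le_rfl n)
    ((summable_exp_neg_mul_int_sq (by positivity : 0 < 2 / c)).mul_left _)

theorem periodizedGaussian_continuous {c : ℝ} (hc : 0 < c) :
    Continuous (periodizedGaussian c) := by
  rw [continuous_iff_continuousAt]
  intro u
  have h : ContinuousOn (periodizedGaussian c) (Metric.ball 0 (|u| + 1)) := by
    refine continuousOn_tsum (fun n => by fun_prop)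
      ((summable_exp_neg_mul_int_sq (by positivity : 0 < 2 / c)).mul_left
        (Real.exp ((|u| + 1) ^ 2 / c))) (fun n v hv => ?_)
    rw [Real.norm_of_nonneg (Real.exp_pos _).le]
    refine exp_neg_shift_sq_le hc ?_ n
    simpa using (mem_ball_zero_iff.mp hv).le
  exact h.continuousAt (Metric.isOpen_ball.mem_nhds (by simp))

theorem periodizedGaussian_periodic (c : ℝ) : Function.Periodic (periodizedGaussian c) 2 := by
  intro u
  unfold periodizedGaussian
  rw [← (Equiv.addRight (1 : ℤ)).tsum_eq (fun n : ℤ => Real.exp (-(2 * (n : ℝ) + u) ^ 2 / c))]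
  refine tsum_congr fun n => ?_
  simp only [Equiv.coe_addRight]
  push_cast
  ring_nf

theorem periodizedGaussian_neg (c u : ℝ) :
    periodizedGaussian c (-u) = periodizedGaussian c u := by
  unfold periodizedGaussian
  rw [← (Equiv.neg ℤ).tsum_eq (fun n : ℤ => Real.exp (-(2 * (n : ℝ) + u) ^ 2 / c))]
  refine tsum_congr fun n => ?_
  simp only [Equiv.neg_apply]
  push_cast
  ring_nf

theorem periodizedGaussian_nonneg (c u : ℝ) : 0 ≤ periodizedGaussian c u :=
  tsum_nonneg fun _ => (Real.exp_pos _).le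

theorem periodizedGaussian_bounded {c : ℝ} (hc : 0 < c) :
    ∃ C, ∀ u, ‖periodizedGaussian c u‖ ≤ C := by
  obtain ⟨C, hC⟩ := isCompact_Icc.exists_bound_of_continuousOn
    (periodizedGaussian_continuous hc).continuousOn (s := Set.Icc (0 : ℝ) 2)
  refine ⟨C, fun u => ?_⟩
  obtain ⟨v, hv, huv⟩ := (periodizedGaussian_periodic c).exists_mem_Ico₀ two_pos u
  rw [huv]
  exact hC v (Set.Ico_subset_Icc_self hv)

theorem periodizedGaussian_sub_mul_intervalIntegrable {c : ℝ} (hc : 0 < c) (x y a b : ℝ) :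
    IntervalIntegrable (fun z => periodizedGaussian c (z - x) * periodizedGaussian c (z - y))
      volume a b := by
  have := periodizedGaussian_continuous hc
  exact Continuous.intervalIntegrable (by fun_prop) _ _

/-- Unfolding: the integral of the `2`-periodization of `F` over a period is the integral of
`F` over the line. -/
theorem intervalIntegral_tsum_comp_add_two_mul_int {F : ℝ → ℝ} (hF : Integrable F)
    (hF0 : ∀ z, 0 ≤ F z) :
    ∫ z in (0 : ℝ)..2, ∑' n : ℤ, F (z + 2 * (n : ℝ)) = ∫ z, F z := by
  have hH : Integrable fun w => F (2 * w) := hF.comp_mul_left' two_ne_zero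
  have hsum := hH.hasSum_intervalIntegral_comp_add_int
  have hint : ∀ n : ℤ, IntegrableOn (fun w => F (2 * (w + (n : ℝ)))) (Set.Ioc 0 1) :=
    fun n => (hH.comp_add_right (n : ℝ)).integrableOn
  have hswap := hasSum_integral_of_summable_integral_norm hint (by
    simpa only [Real.norm_of_nonneg (hF0 _), intervalIntegral.integral_of_le zero_le_one]
      using hsum.summable)
  simp only [intervalIntegral.integral_of_le zero_le_one] at hsum
  have h1 := hswap.unique hsum
  have h2 : ∫ w, F (2 * w) = 2⁻¹ * ∫ z, F z := by
    rw [Measure.integral_comp_mul_left F 2]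
    simp
  have h3 := intervalIntegral.integral_comp_mul_left (a := 0) (b := 1)
    (fun z => ∑' n : ℤ, F (z + 2 * (n : ℝ))) (two_ne_zero' ℝ)
  rw [intervalIntegral.integral_of_le zero_le_one] at h3
  simp only [mul_add] at h1 h2
  rw [h1, h2] at h3
  simpa using h3.symm

theorem exp_neg_sq_mul_exp_neg_sq {c : ℝ} (x y z : ℝ) :
    Real.exp (-(z - x) ^ 2 / c) * Real.exp (-(z - y) ^ 2 / c) =
      Real.exp (-(x - y) ^ 2 / (2 * c)) *
        Real.exp (-(2 / c) * (z - (x + y) / 2) ^ 2) := by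
  rw [← Real.exp_add, ← Real.exp_add]
  congr 1
  ring

theorem integrable_exp_neg_sq_mul_exp_neg_sq {c : ℝ} (hc : 0 < c) (x y : ℝ) :
    Integrable fun z => Real.exp (-(z - x) ^ 2 / c) * Real.exp (-(z - y) ^ 2 / c) := by
  simp only [exp_neg_sq_mul_exp_neg_sq]
  exact ((integrable_exp_neg_mul_sq (by positivity : 0 < 2 / c)).comp_sub_right _).const_mul _

theorem integral_exp_neg_sq_mul_exp_neg_sq {c : ℝ} (x y : ℝ) :
    ∫ z, Real.exp (-(z - x) ^ 2 / c) * Real.exp (-(z - y) ^ 2 / c) =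
      √(π / (2 / c)) * Real.exp (-(x - y) ^ 2 / (2 * c)) := by
  simp only [exp_neg_sq_mul_exp_neg_sq]
  rw [integral_const_mul,
    integral_sub_right_eq_self (fun z => Real.exp (-(2 / c) * z ^ 2)) ((x + y) / 2),
    integral_gaussian, mul_comm]

/-- Integrating a Gaussian against a periodized Gaussian over the line. -/
theorem integral_exp_neg_sq_mul_periodizedGaussian {c : ℝ} (hc : 0 < c) (x y : ℝ) :
    ∫ z, Real.exp (-(z - x) ^ 2 / c) * periodizedGaussian c (z - y) =
      √(π / (2 / c)) * periodizedGaussian (2 * c) (x - y) := by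
  have hterm : ∀ (m : ℤ) (z : ℝ), Real.exp (-(2 * (m : ℝ) + (z - y)) ^ 2 / c) =
      Real.exp (-(z - (y - 2 * (m : ℝ))) ^ 2 / c) := fun m z => by ring_nf
  have hval : ∀ m : ℤ, ∫ z, Real.exp (-(z - x) ^ 2 / c) *
      Real.exp (-(2 * (m : ℝ) + (z - y)) ^ 2 / c) =
      √(π / (2 / c)) * Real.exp (-(2 * (m : ℝ) + (x - y)) ^ 2 / (2 * c)) := fun m => by
    simp only [hterm, integral_exp_neg_sq_mul_exp_neg_sq]
    ring_nf
  have hswap := hasSum_integral_of_summable_integral_norm (μ := volume)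
    (F := fun (m : ℤ) z => Real.exp (-(z - x) ^ 2 / c) *
      Real.exp (-(2 * (m : ℝ) + (z - y)) ^ 2 / c))
    (fun m => by
      simp only [hterm]
      exact integrable_exp_neg_sq_mul_exp_neg_sq hc _ _)
    (by
      simp only [norm_mul, Real.norm_of_nonneg (Real.exp_pos _).le, hval]
      exact (summable_exp_neg_shift_sq (by positivity) _).mul_left _)
  simp only [hval, tsum_mul_left] at hswap
  rw [periodizedGaussian, ← tsum_mul_left]
  exact hswap.tsum_eq.symm

/-- The convolution of two periodized Gaussians over a period. -/
theorem intervalIntegral_periodizedGaussian_mul {c : ℝ} (hc : 0 < c) (x y : ℝ) :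
    ∫ z in (0 : ℝ)..2, periodizedGaussian c (z - x) * periodizedGaussian c (z - y) =
      √(π / (2 / c)) * periodizedGaussian (2 * c) (x - y) := by
  have hcont := periodizedGaussian_continuous hc
  obtain ⟨C, hC⟩ := periodizedGaussian_bounded hc
  have hgauss : Integrable fun z : ℝ => Real.exp (-(z - x) ^ 2 / c) := by
    convert (integrable_exp_neg_mul_sq (by positivity : 0 < 1 / c)).comp_sub_right x using 3
    ring
  have hint : Integrable fun z =>
      Real.exp (-(z - x) ^ 2 / c) * periodizedGaussian c (z - y) :=
    hgauss.mul_bdd (by fun_prop) (Filter.Eventually.of_forall fun z => hC _)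
  rw [← integral_exp_neg_sq_mul_periodizedGaussian hc,
    ← intervalIntegral_tsum_comp_add_two_mul_int hint
      (fun z => mul_nonneg (Real.exp_pos _).le (periodizedGaussian_nonneg _ _))]
  refine intervalIntegral.integral_congr fun z _ => ?_
  rw [periodizedGaussian, ← tsum_mul_right]
  refine tsum_congr fun n => ?_
  have hper : periodizedGaussian c (z + 2 * (n : ℝ) - y) = periodizedGaussian c (z - y) := by
    rw [show z + 2 * (n : ℝ) - y = z - y + n * 2 by ring]
    exact (periodizedGaussian_periodic c).int_mul n _
  rw [hper]
  ring_nf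

theorem tsum_exp_sub_exp_eq_periodizedGaussian {c : ℝ} (hc : 0 < c) (x y : ℝ) :
    ∑' n : ℤ, (Real.exp (-(2 * (n : ℝ) + y - x) ^ 2 / c) -
      Real.exp (-(2 * (n : ℝ) + y + x) ^ 2 / c)) =
      periodizedGaussian c (y - x) - periodizedGaussian c (y + x) := by
  simp only [add_sub_assoc, add_assoc]
  exact (summable_exp_neg_shift_sq hc _).tsum_sub (summable_exp_neg_shift_sq hc _)

theorem intervalIntegral_dirichlet_mul {c : ℝ} (hc : 0 < c) (x y : ℝ) :
    ∫ z in (0 : ℝ)..1, (periodizedGaussian c (z - x) - periodizedGaussian c (z + x)) *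
        (periodizedGaussian c (y - z) - periodizedGaussian c (y + z)) =
      √(π / (2 / c)) *
        (periodizedGaussian (2 * c) (y - x) - periodizedGaussian (2 * c) (y + x)) := by
  set P := periodizedGaussian c with hP
  have hcont : Continuous P := periodizedGaussian_continuous hc
  set f : ℝ → ℝ := fun z => (P (z - x) - P (z + x)) * (P (y - z) - P (y + z)) with hf
  have hfc : Continuous f := by fun_prop
  have hreflect : ∀ u, P (2 - u) = P u := fun u => by
    rw [sub_eq_neg_add, hP, periodizedGaussian_periodic c, periodizedGaussian_neg]
  have hneg : ∀ u, P (-u) = P u := periodizedGaussian_neg c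
  have hsymm : ∀ z, f (2 - z) = f z := fun z => by
    simp only [hf]
    rw [show 2 - z - x = 2 - (z + x) by ring, show 2 - z + x = 2 - (z - x) by ring,
      show y - (2 - z) = -(2 - (y + z)) by ring, show y + (2 - z) = 2 - (z - y) by ring,
      hneg, hreflect, hreflect, hreflect, hreflect, ← hneg (z - y), neg_sub]
    ring
  have hhalf : ∫ z in (1 : ℝ)..2, f z = ∫ z in (0 : ℝ)..1, f z := by
    have h := intervalIntegral.integral_comp_sub_left (a := 0) (b := 1) f 2
    simp only [hsymm] at h
    rw [h]
    norm_num
  have hdouble : ∫ z in (0 : ℝ)..2, f z = 2 * ∫ z in (0 : ℝ)..1, f z := by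
    rw [← intervalIntegral.integral_add_adjacent_intervals (b := 1)
      (hfc.intervalIntegrable _ _) (hfc.intervalIntegrable _ _), hhalf]
    ring
  have hexpand : ∀ z, f z = (P (z - x) * P (z - y) - P (z - x) * P (z - (-y))) -
      (P (z - (-x)) * P (z - y) - P (z - (-x)) * P (z - (-y))) := fun z => by
    simp only [hf]
    rw [← hneg (y - z), neg_sub, sub_neg_eq_add, sub_neg_eq_add, add_comm y z]
    ring
  have hI := periodizedGaussian_sub_mul_intervalIntegrable hc (a := 0) (b := 2)
  have hfull : ∫ z in (0 : ℝ)..2, f z = √(π / (2 / c)) *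
      (2 * (periodizedGaussian (2 * c) (y - x) - periodizedGaussian (2 * c) (y + x))) := by
    simp only [hexpand]
    rw [intervalIntegral.integral_sub ((hI _ _).sub (hI _ _)) ((hI _ _).sub (hI _ _)),
      intervalIntegral.integral_sub (hI _ _) (hI _ _),
      intervalIntegral.integral_sub (hI _ _) (hI _ _)]
    simp only [intervalIntegral_periodizedGaussian_mul hc]
    rw [← periodizedGaussian_neg _ (x - y), ← periodizedGaussian_neg _ (-x - y)]
    ring_nf
  linarith

/-- Closed form of the covariance kernel. -/
theorem covK_eq {ρ : ℝ} (hρ : 0 < ρ) (x y : ℝ) :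
    covK ρ x y = (Real.sqrt (8 * π * ρ))⁻¹ *
      (periodizedGaussian (8 * ρ) (y - x) - periodizedGaussian (8 * ρ) (y + x)) := by
  have h4 : 0 < 4 * ρ := by positivity
  have hconst : (√(4 * π * ρ))⁻¹ * (√(4 * π * ρ))⁻¹ * √(π / (2 / (4 * ρ))) =
      (√(8 * π * ρ))⁻¹ := by
    rw [← mul_inv, Real.mul_self_sqrt (by positivity),
      show π / (2 / (4 * ρ)) = 2 * (π * ρ) by field_simp; norm_num,
      show 8 * π * ρ = 2 ^ 2 * (2 * (π * ρ)) by ring, Real.sqrt_mul (sq_nonneg _),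
      Real.sqrt_sq (by norm_num)]
    field_simp
    rw [Real.sq_sqrt (by positivity)]
    ring
  unfold covK rhoTilde
  simp only [tsum_exp_sub_exp_eq_periodizedGaussian h4]
  rw [← hconst, show 8 * ρ = 2 * (4 * ρ) by ring, mul_assoc _ (√_) _,
    ← intervalIntegral_dirichlet_mul h4, ← intervalIntegral.integral_const_mul]
  refine intervalIntegral.integral_congr fun z _ => ?_
  ring

/-- A real symmetric diagonally dominant matrix is positive semidefinite. -/
theorem Matrix.IsHermitian.posSemidef_of_sum_abs_le_diag {m : Type*} [Fintype m]
    [DecidableEq m] {A : Matrix m m ℝ} (hA : A.IsHermitian)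
    (hdom : ∀ i, ∑ j ∈ Finset.univ.erase i, |A i j| ≤ A i i) : A.PosSemidef := by
  rw [hA.posSemidef_iff_eigenvalues_nonneg]
  intro i
  have hev : Module.End.HasEigenvalue (Matrix.toLin' A) (hA.eigenvalues i) := by
    rw [Module.End.hasEigenvalue_iff_mem_spectrum, Matrix.spectrum_toLin']
    exact hA.eigenvalues_mem_spectrum_real i
  obtain ⟨k, hk⟩ := eigenvalue_mem_ball hev
  rw [Metric.mem_closedBall, Real.dist_eq] at hk
  simp only [Real.norm_eq_abs] at hk
  have h := (abs_le.mp hk).1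
  have h' := hdom k
  simp only [Pi.zero_apply]
  linarith

/-- Lower bound for the smallest eigenvalue of the covariance matrix 𝒦(x_i, x_j). -/
theorem smallest_eigenvalue_lower_bound (n : ℕ) (hn : 1 ≤ n) (ρ : ℝ) (hρ : 0 < ρ)
    (x : Fin n → ℝ) (hx : ∀ i, x i ∈ Set.Ioo (0 : ℝ) 1)
    (c : ℝ)
    -- c is the smallest eigenvalue of K̂: K̂ − c·I is positive semidefinite, and c is the
    -- largest real number with this property.
    (hc₁ : (Matrix.of (fun i j => covK ρ (x i) (x j)) -
      c • (1 : Matrix (Fin n) (Fin n) ℝ)).PosSemidef)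
    (hc₂ : ∀ c' : ℝ, (Matrix.of (fun i j => covK ρ (x i) (x j)) -
      c' • (1 : Matrix (Fin n) (Fin n) ℝ)).PosSemidef → c' ≤ c) :
    c ≥ Finset.univ.inf' (Finset.univ_nonempty_iff.mpr (Fin.pos_iff_nonempty.mp hn))
      (fun i =>
        (Real.sqrt (8 * π * ρ))⁻¹ *
          ∑' k : ℤ, (Real.exp (-(k : ℝ) ^ 2 / (2 * ρ)) -
            Real.exp (-((k : ℝ) + x i) ^ 2 / (2 * ρ))) -
        (Real.sqrt (8 * π * ρ))⁻¹ *
          ∑ j ∈ Finset.univ.erase i,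
            |∑' k : ℤ, (Real.exp (-(2 * (k : ℝ) + x j - x i) ^ 2 / (8 * ρ)) -
              Real.exp (-(2 * (k : ℝ) + x j + x i) ^ 2 / (8 * ρ)))|) := by
  have h8 : 0 < 8 * ρ := by positivity
  have hdiag : ∀ i, ∑' k : ℤ, (Real.exp (-(k : ℝ) ^ 2 / (2 * ρ)) -
      Real.exp (-((k : ℝ) + x i) ^ 2 / (2 * ρ))) =
      periodizedGaussian (8 * ρ) (x i - x i) - periodizedGaussian (8 * ρ) (x i + x i) := by
    intro i
    rw [← tsum_exp_sub_exp_eq_periodizedGaussian h8]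
    refine tsum_congr fun k => ?_
    congr 2 <;> field_simp <;> ring
  refine hc₂ _ ?_
  refine Matrix.IsHermitian.posSemidef_of_sum_abs_le_diag ?_ fun i => ?_
  · ext i j
    simp only [Matrix.conjTranspose_apply, Matrix.sub_apply, Matrix.of_apply, Matrix.smul_apply,
      star_trivial, Matrix.one_apply, eq_comm (a := j), covK_eq hρ]
    rw [← periodizedGaussian_neg _ (x i - x j), neg_sub, add_comm (x i)]
  · have hmin := Finset.inf'_le (fun i =>
        (Real.sqrt (8 * π * ρ))⁻¹ *
          ∑' k : ℤ, (Real.exp (-(k : ℝ) ^ 2 / (2 * ρ)) -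
            Real.exp (-((k : ℝ) + x i) ^ 2 / (2 * ρ))) -
        (Real.sqrt (8 * π * ρ))⁻¹ *
          ∑ j ∈ Finset.univ.erase i,
            |∑' k : ℤ, (Real.exp (-(2 * (k : ℝ) + x j - x i) ^ 2 / (8 * ρ)) -
              Real.exp (-(2 * (k : ℝ) + x j + x i) ^ 2 / (8 * ρ)))|) (Finset.mem_univ i)
    set b := (Finset.univ : Finset (Fin n)).inf' (α := ℝ) _ _
    simp only [hdiag, tsum_exp_sub_exp_eq_periodizedGaussian h8] at hmin
    have hoff : ∑ j ∈ Finset.univ.erase i, |(Matrix.of (fun i j => covK ρ (x i) (x j)) -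
        b • (1 : Matrix (Fin n) (Fin n) ℝ)) i j| = (√(8 * π * ρ))⁻¹ *
        ∑ j ∈ Finset.univ.erase i, |periodizedGaussian (8 * ρ) (x j - x i) -
          periodizedGaussian (8 * ρ) (x j + x i)| := by
      rw [Finset.mul_sum]
      refine Finset.sum_congr rfl fun j hj => ?_
      simp [Matrix.one_apply_ne' (Finset.ne_of_mem_erase hj), covK_eq hρ, abs_mul,
        abs_of_nonneg]
    rw [hoff]
    simp only [Matrix.sub_apply, Matrix.of_apply, Matrix.smul_apply, Matrix.one_apply_eq,
      smul_eq_mul, mul_one, covK_eq hρ]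
    linarith
end

section
/- Let 0 < ε < 1, 0 < δ < 1, and γ ∈ ℝ, and set b(x) := U_{ε,δ}(x) + (1 − γ)x. Then for every continuously differentiable function u : [0,1] → ℝ and every positive integer k, |∫₀¹ b′(u(x))·cos(kπx) dx| ≤ (Ĵ/(kπ)) · ((1 − ε²)/(εδ)) · (∫₀¹ u′(x)² dx)^{1/2}. -/
open Real

/-- The bump function J̃(x) = Ĵ·exp(−1/(1−x²)) for |x| < 1, and 0 otherwise. -/
noncomputable def Jtilde (Jhat x : ℝ) : ℝ :=
  if |x| < 1 then Jhat * Real.exp (-1 / (1 - x ^ 2)) else 0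

/-- The mollifier J^δ(x) = δ⁻¹·J̃(x/δ). -/
noncomputable def Jmoll (Jhat δ x : ℝ) : ℝ := δ⁻¹ * Jtilde Jhat (x / δ)

/-- The inverse g_ε⁻¹ of the regularized sign function. -/
noncomputable def gInv (ε x : ℝ) : ℝ :=
  if 1 ≤ x then x / ε + ε - 1 / ε
  else if x ≤ -1 then x / ε - ε + 1 / ε
  else ε * x

/-- U_{ε,δ}(x) := −(J^δ ∗ g_ε⁻¹)(x), the negative of the mollification of g_ε⁻¹. -/
noncomputable def Ureg (Jhat ε δ x : ℝ) : ℝ := -∫ y : ℝ, Jmoll Jhat δ y * gInv ε (x - y)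

/-- The drift b(x) := U_{ε,δ}(x) + (1−γ)x. -/
noncomputable def drift (Jhat ε δ γ x : ℝ) : ℝ := Ureg Jhat ε δ x + (1 - γ) * x

open MeasureTheory

lemma Jtilde_eq_expNegInvGlue (Jhat x : ℝ) :
    Jtilde Jhat x = Jhat * expNegInvGlue (1 - x ^ 2) := by
  unfold Jtilde expNegInvGlue
  by_cases h : |x| < 1
  · have h' : ¬ (1 - x ^ 2 ≤ 0) := by
      have := (sq_lt_one_iff_abs_lt_one x).2 h
      linarith
    rw [if_pos h, if_neg h', neg_div, one_div]
  · have h' : 1 - x ^ 2 ≤ 0 := by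
      have := mt (sq_lt_one_iff_abs_lt_one x).1 h
      linarith
    rw [if_neg h, if_pos h', mul_zero]

lemma continuous_Jmoll (Jhat δ : ℝ) : Continuous (Jmoll Jhat δ) := by
  have h : Continuous expNegInvGlue := (expNegInvGlue.contDiff (n := 0)).continuous
  unfold Jmoll
  simp only [Jtilde_eq_expNegInvGlue]
  fun_prop

lemma Jmoll_nonneg {Jhat δ : ℝ} (hJhat : 0 ≤ Jhat) (hδ : 0 ≤ δ) (x : ℝ) :
    0 ≤ Jmoll Jhat δ x := by
  rw [Jmoll, Jtilde_eq_expNegInvGlue]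
  have := expNegInvGlue.nonneg (1 - (x / δ) ^ 2)
  positivity

lemma Jmoll_le {Jhat δ : ℝ} (hJhat : 0 ≤ Jhat) (hδ : 0 ≤ δ) (x : ℝ) :
    Jmoll Jhat δ x ≤ Jhat / δ := by
  have h : expNegInvGlue (1 - (x / δ) ^ 2) ≤ 1 := by
    unfold expNegInvGlue
    split_ifs with h
    · exact zero_le_one
    · exact Real.exp_le_one_iff.2 (neg_nonpos.2 (inv_nonneg.2 (not_le.1 h).le))
  rw [Jmoll, Jtilde_eq_expNegInvGlue, div_eq_inv_mul Jhat]
  exact mul_le_mul_of_nonneg_left (mul_le_of_le_one_right hJhat h) (inv_nonneg.2 hδ)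

lemma Jmoll_eq_zero {Jhat δ x : ℝ} (hδ : 0 < δ) (hx : δ ≤ |x|) : Jmoll Jhat δ x = 0 := by
  have h : ¬ |x / δ| < 1 := by
    rw [abs_div, abs_of_pos hδ, not_lt, le_div_iff₀ hδ, one_mul]
    exact hx
  rw [Jmoll, Jtilde, if_neg h, mul_zero]

lemma integrable_Jmoll_mul (Jhat : ℝ) {δ : ℝ} (hδ : 0 < δ) {f : ℝ → ℝ} (hf : Continuous f) :
    Integrable fun y => Jmoll Jhat δ y * f y := by
  refine ((continuous_Jmoll Jhat δ).mul hf).integrable_of_hasCompactSupport ?_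
  refine HasCompactSupport.intro (isCompact_Icc (a := -δ) (b := δ)) fun y hy => ?_
  have h : δ ≤ |y| := by
    by_contra h
    exact hy (abs_le.1 (not_le.1 h).le)
  simp [Jmoll_eq_zero hδ h]

/-- The convolution of the mollifier with the positive part, as an integral up to `z`. -/
lemma integral_Jmoll_mul_posPart (Jhat : ℝ) {δ : ℝ} (hδ : 0 < δ) (z : ℝ) :
    ∫ y, Jmoll Jhat δ y * max (z - y) 0 = ∫ y in (-δ)..z, Jmoll Jhat δ y * (z - y) := by
  have hint : Integrable fun y => Jmoll Jhat δ y * (z - y) :=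
    integrable_Jmoll_mul Jhat hδ (by fun_prop)
  have hind : (fun y => Jmoll Jhat δ y * max (z - y) 0) =
      (Set.Iic z).indicator fun y => Jmoll Jhat δ y * (z - y) := by
    funext y
    by_cases hy : y ≤ z
    · rw [Set.indicator_of_mem (Set.mem_Iic.2 hy), max_eq_left (sub_nonneg.2 hy)]
    · rw [Set.indicator_of_notMem (by simpa using hy), max_eq_right (by linarith), mul_zero]
  have hzero : ∫ y in Set.Iic (-δ), Jmoll Jhat δ y * (z - y) = 0 := by
    refine setIntegral_eq_zero_of_forall_eq_zero fun y hy => ?_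
    have : δ ≤ |y| := by
      rw [abs_of_nonpos (by linarith [Set.mem_Iic.1 hy])]
      linarith [Set.mem_Iic.1 hy]
    rw [Jmoll_eq_zero hδ this, zero_mul]
  rw [hind, integral_indicator measurableSet_Iic,
    ← intervalIntegral.integral_Iic_sub_Iic hint.integrableOn hint.integrableOn, hzero, sub_zero]

lemma hasDerivAt_integral_Jmoll (Jhat δ z : ℝ) :
    HasDerivAt (fun z => ∫ y in (-δ)..z, Jmoll Jhat δ y) (Jmoll Jhat δ z) z :=
  (continuous_Jmoll Jhat δ).integral_hasStrictDerivAt _ _ |>.hasDerivAt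

lemma hasDerivAt_integral_Jmoll_mul_posPart (Jhat : ℝ) {δ : ℝ} (hδ : 0 < δ) (z : ℝ) :
    HasDerivAt (fun z => ∫ y, Jmoll Jhat δ y * max (z - y) 0)
      (∫ y in (-δ)..z, Jmoll Jhat δ y) z := by
  have hJ := continuous_Jmoll Jhat δ
  have hJy : Continuous fun y => Jmoll Jhat δ y * y := hJ.mul continuous_id
  have hJc (c : ℝ) : Continuous fun y => Jmoll Jhat δ y * c := hJ.mul continuous_const
  have heq : (fun z => ∫ y, Jmoll Jhat δ y * max (z - y) 0) = fun z =>
      (∫ y in (-δ)..z, Jmoll Jhat δ y) * z - ∫ y in (-δ)..z, Jmoll Jhat δ y * y := by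
    funext z
    rw [integral_Jmoll_mul_posPart Jhat hδ, ← intervalIntegral.integral_mul_const,
      ← intervalIntegral.integral_sub ((hJc z).intervalIntegrable _ _)
        (hJy.intervalIntegrable _ _)]
    simp only [mul_sub]
  rw [heq]
  have h := ((hasDerivAt_integral_Jmoll Jhat δ z).mul (hasDerivAt_id z)).sub
    (hJy.integral_hasStrictDerivAt (-δ) z).hasDerivAt
  exact h.congr_deriv (by simp)

lemma gInv_eq_posPart {ε : ℝ} (hε : ε ≠ 0) (x : ℝ) :
    gInv ε x = x / ε + (1 / ε - ε) * (max (x - 1) 0 - max (x + 1) 0 + 1) := by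
  unfold gInv
  split_ifs with h₁ h₂
  · rw [max_eq_left (by linarith), max_eq_left (by linarith)]
    ring
  · rw [max_eq_right (by linarith), max_eq_right (by linarith)]
    ring
  · rw [max_eq_right (by linarith), max_eq_left (by linarith)]
    field_simp
    ring

lemma Ureg_eq (Jhat : ℝ) {ε δ : ℝ} (hε : ε ≠ 0) (hδ : 0 < δ) (x : ℝ) :
    Ureg Jhat ε δ x =
      -((∫ y, Jmoll Jhat δ y * 1) * (x / ε + (1 / ε - ε)) -
          (∫ y, Jmoll Jhat δ y * y) / ε +
        (1 / ε - ε) * ((∫ y, Jmoll Jhat δ y * max (x - 1 - y) 0) -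
          ∫ y, Jmoll Jhat δ y * max (x + 1 - y) 0)) := by
  have h₀ := integrable_Jmoll_mul Jhat hδ (continuous_const (y := (1 : ℝ)))
  have h₁ := integrable_Jmoll_mul Jhat hδ continuous_id'
  have hp (z : ℝ) := integrable_Jmoll_mul Jhat hδ (f := fun y => max (z - y) 0) (by fun_prop)
  have hl : Integrable fun y => Jmoll Jhat δ y * 1 * (x / ε + (1 / ε - ε)) -
      Jmoll Jhat δ y * y / ε := (h₀.mul_const _).sub (h₁.div_const _)
  have hd : Integrable fun y => (1 / ε - ε) * (Jmoll Jhat δ y * max (x - 1 - y) 0 -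
      Jmoll Jhat δ y * max (x + 1 - y) 0) := ((hp _).sub (hp _)).const_mul _
  rw [Ureg, ← integral_sub (hp _) (hp _), ← integral_const_mul, ← integral_mul_const,
    ← integral_div, ← integral_sub (h₀.mul_const _) (h₁.div_const _), ← integral_add hl hd]
  congr 1
  refine integral_congr_ae (Filter.Eventually.of_forall fun y => ?_)
  simp only [gInv_eq_posPart hε, sub_right_comm x y 1, sub_add_eq_add_sub x y 1]
  ring

lemma deriv_drift (Jhat γ : ℝ) {ε δ : ℝ} (hε : ε ≠ 0) (hδ : 0 < δ) :
    deriv (drift Jhat ε δ γ) = fun x =>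
      -((∫ y, Jmoll Jhat δ y * 1) * (1 / ε) + (1 / ε - ε) *
        ((∫ y in (-δ)..(x - 1), Jmoll Jhat δ y) - ∫ y in (-δ)..(x + 1), Jmoll Jhat δ y)) +
      (1 - γ) := by
  funext x
  have heq : drift Jhat ε δ γ = fun x => _ :=
    funext fun x => congrArg (· + (1 - γ) * x) (Ureg_eq Jhat hε hδ x)
  rw [heq]
  have hm := (hasDerivAt_integral_Jmoll_mul_posPart Jhat hδ (x - 1)).comp_sub_const x 1
  have hp := (hasDerivAt_integral_Jmoll_mul_posPart Jhat hδ (x + 1)).comp_add_const x 1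
  have hl := (((((hasDerivAt_id x).div_const ε).add_const (1 / ε - ε)).const_mul
    (∫ y, Jmoll Jhat δ y * 1)).sub_const ((∫ y, Jmoll Jhat δ y * y) / ε))
  have h := (hl.add ((hm.sub hp).const_mul (1 / ε - ε))).neg.add
    ((hasDerivAt_id x).const_mul (1 - γ))
  rw [mul_one] at h
  exact h.deriv

lemma hasDerivAt_deriv_drift (Jhat γ : ℝ) {ε δ : ℝ} (hε : ε ≠ 0) (hδ : 0 < δ) (x : ℝ) :
    HasDerivAt (deriv (drift Jhat ε δ γ))
      (-((1 / ε - ε) * (Jmoll Jhat δ (x - 1) - Jmoll Jhat δ (x + 1)))) x := by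
  rw [deriv_drift Jhat γ hε hδ]
  have hm := (hasDerivAt_integral_Jmoll Jhat δ (x - 1)).comp_sub_const x 1
  have hp := (hasDerivAt_integral_Jmoll Jhat δ (x + 1)).comp_add_const x 1
  exact ((((hm.sub hp).const_mul (1 / ε - ε)).const_add _).neg).add_const _

lemma abs_drift_second_deriv_le {Jhat ε δ : ℝ} (hJhat : 0 ≤ Jhat) (hε : 0 < ε) (hε1 : ε ≤ 1)
    (hδ : 0 ≤ δ) (x : ℝ) :
    |-((1 / ε - ε) * (Jmoll Jhat δ (x - 1) - Jmoll Jhat δ (x + 1)))| ≤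
      Jhat * ((1 - ε ^ 2) / (ε * δ)) := by
  have hc : 1 / ε - ε = (1 - ε ^ 2) / ε := by field_simp
  have hc0 : 0 ≤ (1 - ε ^ 2) / ε := div_nonneg (by nlinarith) hε.le
  have hJ : |Jmoll Jhat δ (x - 1) - Jmoll Jhat δ (x + 1)| ≤ Jhat / δ :=
    abs_sub_le_of_nonneg_of_le (Jmoll_nonneg hJhat hδ _) (Jmoll_le hJhat hδ _)
      (Jmoll_nonneg hJhat hδ _) (Jmoll_le hJhat hδ _)
  rw [abs_neg, abs_mul, hc, abs_of_nonneg hc0]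
  calc _ ≤ (1 - ε ^ 2) / ε * (Jhat / δ) := mul_le_mul_of_nonneg_left hJ hc0
    _ = _ := by rw [div_mul_div_comm, mul_comm (1 - ε ^ 2), mul_div_assoc]

/-- The Cauchy–Schwarz inequality against the constant `1` on the unit interval. -/
lemma integral_abs_le_sqrt_integral_sq {f : ℝ → ℝ} (hf : ContinuousOn f (Set.Icc 0 1)) :
    ∫ x in (0 : ℝ)..1, |f x| ≤ √(∫ x in (0 : ℝ)..1, f x ^ 2) := by
  rw [← Set.uIcc_of_le zero_le_one] at hf
  set m := ∫ x in (0 : ℝ)..1, |f x| with hm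
  have h₁ : IntervalIntegrable (fun x => |f x|) volume 0 1 := hf.abs.intervalIntegrable
  have h₂ : IntervalIntegrable (fun x => f x ^ 2) volume 0 1 := (hf.pow 2).intervalIntegrable
  have h : ∫ x in (0 : ℝ)..1, (|f x| - m) ^ 2 = (∫ x in (0 : ℝ)..1, f x ^ 2) - m ^ 2 := by
    have heq (x : ℝ) : (|f x| - m) ^ 2 = f x ^ 2 - 2 * m * |f x| + m ^ 2 := by
      rw [← sq_abs (f x)]
      ring
    simp only [heq]
    rw [intervalIntegral.integral_add (h₂.sub (h₁.const_mul _)) intervalIntegrable_const,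
      intervalIntegral.integral_sub h₂ (h₁.const_mul _), intervalIntegral.integral_const_mul,
      ← hm, intervalIntegral.integral_const, sub_zero, one_smul]
    ring
  have h0 : 0 ≤ ∫ x in (0 : ℝ)..1, (|f x| - m) ^ 2 :=
    intervalIntegral.integral_nonneg zero_le_one fun x _ => sq_nonneg _
  exact Real.le_sqrt_of_sq_le (by linarith)

/-- Decay of the cosine coefficients of a `C¹` function with derivative dominated by `C * |g|`. -/
lemma abs_integral_mul_cos_le {f f' g : ℝ → ℝ} {C : ℝ}
    (hf : ∀ x ∈ Set.Icc (0 : ℝ) 1, HasDerivAt f (f' x) x)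
    (hf' : ContinuousOn f' (Set.Icc 0 1)) (hg : ContinuousOn g (Set.Icc 0 1))
    (hfg : ∀ x ∈ Set.Icc (0 : ℝ) 1, |f' x| ≤ C * |g x|) {k : ℕ} (hk : 1 ≤ k) :
    |∫ x in (0 : ℝ)..1, f x * cos (k * π * x)| ≤
      C / (k * π) * ∫ x in (0 : ℝ)..1, |g x| := by
  have hu : Set.uIcc (0 : ℝ) 1 = Set.Icc 0 1 := Set.uIcc_of_le zero_le_one
  have hkπ : 0 < (k : ℝ) * π := mul_pos (by exact_mod_cast hk) pi_pos
  have hsin (x : ℝ) : HasDerivAt (fun x => sin (k * π * x) / (k * π)) (cos (k * π * x)) x := by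
    have h := (((hasDerivAt_id x).const_mul ((k : ℝ) * π)).sin).div_const ((k : ℝ) * π)
    exact h.congr_deriv (by simp [hkπ.ne'])
  rw [intervalIntegral.integral_mul_deriv_eq_deriv_mul (u' := f') (fun x hx => hf x (hu ▸ hx))
    (fun x _ => hsin x) ((hu ▸ hf').intervalIntegrable)
    (Continuous.intervalIntegrable (by fun_prop) _ _)]
  simp only [mul_one, mul_zero, sin_zero, sin_nat_mul_pi, zero_div, sub_zero, zero_sub, abs_neg]
  rw [← intervalIntegral.integral_const_mul]
  refine intervalIntegral.norm_integral_le_of_norm_le (f := fun x => f' x * _) zero_le_one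
    (Filter.Eventually.of_forall fun x hx => ?_)
    (((hu ▸ hg).abs.intervalIntegrable).const_mul _)
  rw [norm_mul, norm_div, Real.norm_eq_abs, Real.norm_eq_abs, Real.norm_of_nonneg hkπ.le,
    div_mul_eq_mul_div, mul_div_assoc']
  refine div_le_div_of_nonneg_right ?_ hkπ.le
  calc |f' x| * |sin (k * π * x)| ≤ |f' x| :=
        mul_le_of_le_one_right (abs_nonneg _) (abs_sin_le_one _)
    _ ≤ C * |g x| := hfg x (Set.Ioc_subset_Icc_self hx)

/-- Bound on the Fourier cosine coefficients of b′∘u for a C¹ function u on [0,1]. -/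
theorem drift_deriv_fourier_bound (ε δ γ Jhat : ℝ) (hε : 0 < ε) (hε1 : ε < 1)
    (hδ : 0 < δ) (hδ1 : δ < 1) (hJhat : 0 < Jhat) (hnorm : ∫ x : ℝ, Jtilde Jhat x = 1)
    (u u' : ℝ → ℝ) (hu : ∀ x ∈ Set.Icc (0 : ℝ) 1, HasDerivAt u (u' x) x)
    (hu' : ContinuousOn u' (Set.Icc (0 : ℝ) 1))
    (k : ℕ) (hk : 1 ≤ k) :
    |∫ x in (0 : ℝ)..1, deriv (drift Jhat ε δ γ) (u x) * Real.cos ((k : ℝ) * π * x)| ≤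
      Jhat / ((k : ℝ) * π) * ((1 - ε ^ 2) / (ε * δ)) *
        Real.sqrt (∫ x in (0 : ℝ)..1, (u' x) ^ 2) := by
  set b'' : ℝ → ℝ := fun y =>
    -((1 / ε - ε) * (Jmoll Jhat δ (y - 1) - Jmoll Jhat δ (y + 1)))
  have hb_cont : Continuous b'' := by
    have := continuous_Jmoll Jhat δ
    fun_prop
  have hu_cont : ContinuousOn u (Set.Icc 0 1) := fun x hx =>
    (hu x hx).continuousAt.continuousWithinAt
  have hC : 0 ≤ Jhat * ((1 - ε ^ 2) / (ε * δ)) :=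
    (abs_nonneg _).trans (abs_drift_second_deriv_le hJhat.le hε hε1.le hδ.le 0)
  have h := abs_integral_mul_cos_le (f := fun x => deriv (drift Jhat ε δ γ) (u x))
    (f' := fun x => b'' (u x) * u' x) (g := u') (C := Jhat * ((1 - ε ^ 2) / (ε * δ)))
    (fun x hx => (hasDerivAt_deriv_drift Jhat γ hε.ne' hδ (u x)).comp x (hu x hx))
    ((hb_cont.comp_continuousOn hu_cont).mul hu') hu'
    (fun x _ => by
      rw [abs_mul]
      exact mul_le_mul_of_nonneg_right
        (abs_drift_second_deriv_le hJhat.le hε hε1.le hδ.le (u x)) (abs_nonneg _)) hk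
  rw [div_mul_eq_mul_div Jhat]
  exact h.trans (mul_le_mul_of_nonneg_left (integral_abs_le_sqrt_integral_sq hu')
    (div_nonneg hC (by positivity)))
end

section
/- For every x ∈ (0,1) and every ρ > 0, one has |√(8πρ)·𝒦(x,x) − 1| ≤ 2ρ·(1/x² + 1/(x−1)²) + (2π²/3)·ρ; equivalently, (8πρ)^{−1/2} − C_x·√ρ/√(8π) ≤ 𝒦(x,x) ≤ (8πρ)^{−1/2} + C_x·√ρ/√(8π), where C_x := 2·(1/x² + 1/(x−1)²) + 2π²/3. -/
open Real

open MeasureTheory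

/-- The periodization `∑ₙ exp (-(n + v)² / s)` of a Gaussian over the integers. -/
noncomputable def perGauss (s v : ℝ) : ℝ := ∑' n : ℤ, Real.exp (-((n : ℝ) + v) ^ 2 / s)

lemma exp_neg_sq_div_le {s u : ℝ} (hs : 0 < s) (hu : u ≠ 0) :
    Real.exp (-u ^ 2 / s) ≤ s * (1 / u ^ 2) := by
  have hu2 : 0 < u ^ 2 := by positivity
  have h : u ^ 2 / s ≤ Real.exp (u ^ 2 / s) := by linarith [Real.add_one_le_exp (u ^ 2 / s)]
  calc Real.exp (-u ^ 2 / s) = (Real.exp (u ^ 2 / s))⁻¹ := by rw [neg_div, Real.exp_neg]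
    _ ≤ (u ^ 2 / s)⁻¹ := inv_anti₀ (by positivity) h
    _ = s * (1 / u ^ 2) := by rw [inv_div]; ring

lemma hasSum_int_one_div_sq : HasSum (fun n : ℤ => (1 : ℝ) / (n : ℝ) ^ 2) (π ^ 2 / 3) := by
  have h := HasSum.of_nat_of_neg (f := fun n : ℤ => (1 : ℝ) / (n : ℝ) ^ 2)
    (by simpa using hasSum_zeta_two) (by simpa using hasSum_zeta_two)
  convert! h using 1
  simp
  ring

lemma summable_exp_neg_int_sq_div {s : ℝ} (hs : 0 < s) :
    Summable fun n : ℤ => Real.exp (-(n : ℝ) ^ 2 / s) := by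
  refine Summable.of_norm_bounded_eventually (hasSum_int_one_div_sq.summable.mul_left s) ?_
  filter_upwards [(Set.finite_singleton (0 : ℤ)).compl_mem_cofinite] with n hn
  rw [Real.norm_of_nonneg (Real.exp_pos _).le]
  exact exp_neg_sq_div_le hs (by simpa using hn)

lemma exp_neg_int_add_sq_div_le {s : ℝ} (hs : 0 < s) (n : ℤ) (v : ℝ) :
    Real.exp (-((n : ℝ) + v) ^ 2 / s) ≤
      Real.exp (v ^ 2 / s) * Real.exp (-(n : ℝ) ^ 2 / (2 * s)) := by
  rw [← Real.exp_add, Real.exp_le_exp,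
    show v ^ 2 / s + -(n : ℝ) ^ 2 / (2 * s) = (v ^ 2 - (n : ℝ) ^ 2 / 2) / s by field_simp; ring]
  gcongr
  nlinarith [sq_nonneg ((n : ℝ) + 2 * v)]

lemma summable_perGauss {s : ℝ} (hs : 0 < s) (v : ℝ) :
    Summable fun n : ℤ => Real.exp (-((n : ℝ) + v) ^ 2 / s) :=
  Summable.of_nonneg_of_le (fun _ => (Real.exp_pos _).le)
    (fun n => exp_neg_int_add_sq_div_le hs n v)
    ((summable_exp_neg_int_sq_div (by positivity : 0 < 2 * s)).mul_left _)

lemma perGauss_nonneg (s v : ℝ) : 0 ≤ perGauss s v := tsum_nonneg fun _ => (Real.exp_pos _).le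

lemma perGauss_neg (s v : ℝ) : perGauss s (-v) = perGauss s v := by
  unfold perGauss
  rw [← (Equiv.neg ℤ).tsum_eq]
  refine tsum_congr fun n => ?_
  simp only [Equiv.neg_apply, Int.cast_neg]
  ring_nf

lemma perGauss_periodic (s : ℝ) : Function.Periodic (perGauss s) 1 := fun v => by
  unfold perGauss
  rw [← (Equiv.addRight (1 : ℤ)).tsum_eq (fun n : ℤ => Real.exp (-((n : ℝ) + v) ^ 2 / s))]
  refine tsum_congr fun n => ?_
  simp only [Equiv.coe_addRight, Int.cast_add, Int.cast_one]
  ring_nf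

lemma continuous_perGauss {s : ℝ} (hs : 0 < s) : Continuous (perGauss s) := by
  refine continuous_iff_continuousAt.2 fun v => ?_
  have h : ContinuousOn (perGauss s) (Metric.ball 0 (|v| + 1)) := by
    refine continuousOn_tsum
      (u := fun n : ℤ => Real.exp ((|v| + 1) ^ 2 / s) * Real.exp (-(n : ℝ) ^ 2 / (2 * s)))
      (fun n => by fun_prop)
      ((summable_exp_neg_int_sq_div (by positivity : 0 < 2 * s)).mul_left _) fun n w hw => ?_
    rw [Real.norm_of_nonneg (Real.exp_pos _).le]
    refine (exp_neg_int_add_sq_div_le hs n w).trans ?_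
    have hw' : |w| ≤ |v| + 1 := by
      rw [mem_ball_zero_iff, Real.norm_eq_abs] at hw
      exact hw.le
    have : w ^ 2 ≤ (|v| + 1) ^ 2 := sq_le_sq.2 (hw'.trans (le_abs_self _))
    gcongr
  exact h.continuousAt (Metric.isOpen_ball.mem_nhds (by simp))

lemma exists_perGauss_le {s : ℝ} (hs : 0 < s) : ∃ C, ∀ v, ‖perGauss s v‖ ≤ C := by
  obtain ⟨C, hC⟩ := ((perGauss_periodic s).isBounded_of_continuous one_ne_zero
    (continuous_perGauss hs)).exists_norm_le
  exact ⟨C, fun v => hC _ ⟨v, rfl⟩⟩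

lemma integrable_exp_neg_add_sq_div {s : ℝ} (hs : 0 < s) (a : ℝ) :
    Integrable fun w : ℝ => Real.exp (-(w + a) ^ 2 / s) := by
  have h := (integrable_exp_neg_mul_sq (inv_pos.2 hs)).comp_add_right a
  refine h.congr (Filter.Eventually.of_forall fun w => ?_)
  simp only
  ring_nf

lemma exp_mul_exp_eq {s : ℝ} (hs : 0 < s) (m a w : ℝ) :
    Real.exp (-(m + w) ^ 2 / s) * Real.exp (-(w + a) ^ 2 / s) =
      Real.exp (-(m + -a) ^ 2 / (2 * s)) * Real.exp (-(2 / s) * (w + (m + a) / 2) ^ 2) := by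
  rw [← Real.exp_add, ← Real.exp_add]
  congr 1
  field_simp
  ring

lemma integrable_exp_mul_exp {s : ℝ} (hs : 0 < s) (m a : ℝ) :
    Integrable fun w : ℝ => Real.exp (-(m + w) ^ 2 / s) * Real.exp (-(w + a) ^ 2 / s) := by
  simp_rw [exp_mul_exp_eq hs]
  exact ((integrable_exp_neg_mul_sq (by positivity : 0 < 2 / s)).comp_add_right _).const_mul _

/-- The product of two Gaussians integrates to a Gaussian of twice the variance. -/
lemma integral_exp_mul_exp {s : ℝ} (hs : 0 < s) (m a : ℝ) :
    ∫ w : ℝ, Real.exp (-(m + w) ^ 2 / s) * Real.exp (-(w + a) ^ 2 / s) =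
      √(π * s / 2) * Real.exp (-(m + -a) ^ 2 / (2 * s)) := by
  simp_rw [exp_mul_exp_eq hs]
  rw [integral_const_mul,
    integral_add_right_eq_self (fun w : ℝ => Real.exp (-(2 / s) * w ^ 2)), integral_gaussian,
    mul_comm, div_div_eq_mul_div]

lemma integral_perGauss_mul_exp {s : ℝ} (hs : 0 < s) (a : ℝ) :
    ∫ w : ℝ, perGauss s w * Real.exp (-(w + a) ^ 2 / s) =
      √(π * s / 2) * perGauss (2 * s) a := by
  have h := hasSum_integral_of_summable_integral_norm
    (F := fun (m : ℤ) (w : ℝ) => Real.exp (-((m : ℝ) + w) ^ 2 / s) * Real.exp (-(w + a) ^ 2 / s))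
    (μ := volume) (fun m => integrable_exp_mul_exp hs m a) (by
      simp_rw [norm_mul, Real.norm_of_nonneg (Real.exp_pos _).le, integral_exp_mul_exp hs]
      exact (summable_perGauss (by positivity : 0 < 2 * s) (-a)).mul_left _)
  simp_rw [integral_exp_mul_exp hs, tsum_mul_right] at h
  change ∫ w : ℝ, (∑' m : ℤ, Real.exp (-((m : ℝ) + w) ^ 2 / s)) * _ = _
  rw [← h.tsum_eq, tsum_mul_left, ← perGauss_neg]
  rfl

/-- Unfolding: the correlation over a period of the periodized Gaussian. -/
lemma integral_perGauss_mul_perGauss {s : ℝ} (hs : 0 < s) (a : ℝ) :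
    ∫ w in (0 : ℝ)..1, perGauss s w * perGauss s (w + a) =
      √(π * s / 2) * perGauss (2 * s) a := by
  obtain ⟨C, hC⟩ := exists_perGauss_le hs
  have hint : Integrable fun w : ℝ => perGauss s w * Real.exp (-(w + a) ^ 2 / s) :=
    (integrable_exp_neg_add_sq_div hs a).bdd_mul (continuous_perGauss hs).aestronglyMeasurable
      (Filter.Eventually.of_forall hC)
  have hper : ∀ (w : ℝ) (n : ℤ), perGauss s (w + n) = perGauss s w := fun w n => by
    simpa using (perGauss_periodic s).int_mul n w
  have hsum := hint.hasSum_intervalIntegral_comp_add_int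
  simp_rw [hper] at hsum
  have hcont : ∀ n : ℤ, Continuous fun w : ℝ =>
      perGauss s w * Real.exp (-(w + n + a) ^ 2 / s) := fun n =>
    (continuous_perGauss hs).mul (by fun_prop)
  rw [← integral_perGauss_mul_exp hs, ← hsum.tsum_eq]
  simp_rw [intervalIntegral.integral_of_le zero_le_one] at hsum ⊢
  rw [(hasSum_integral_of_summable_integral_norm
    (F := fun (n : ℤ) (w : ℝ) => perGauss s w * Real.exp (-(w + n + a) ^ 2 / s))
    (fun n => (hcont n).integrableOn_Ioc) ?_).tsum_eq]
  · congr 1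
    ext w
    rw [tsum_mul_left]
    congr 1
    refine tsum_congr fun n => ?_
    ring_nf
  · simp_rw [norm_mul, Real.norm_of_nonneg (Real.exp_pos _).le,
      Real.norm_of_nonneg (perGauss_nonneg _ _)]
    exact hsum.summable

lemma integral_perGauss_sub_sq {s : ℝ} (hs : 0 < s) (y : ℝ) :
    ∫ w in (0 : ℝ)..1, (perGauss s (w - y) - perGauss s (w + y)) ^ 2 =
      2 * √(π * s / 2) * (perGauss (2 * s) 0 - perGauss (2 * s) (2 * y)) := by
  have hc := continuous_perGauss hs
  have key : ∀ a b : ℝ, ∫ w in (0 : ℝ)..1, perGauss s (w + a) * perGauss s (w + b) =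
      √(π * s / 2) * perGauss (2 * s) (b - a) := fun a b => by
    rw [← integral_perGauss_mul_perGauss hs]
    have hp : Function.Periodic (fun w => perGauss s w * perGauss s (w + (b - a))) 1 := fun w => by
      simp only [perGauss_periodic s w]
      rw [show w + 1 + (b - a) = w + (b - a) + 1 by ring, perGauss_periodic s]
    have h1 := intervalIntegral.integral_comp_add_right (a := 0) (b := 1)
      (fun w => perGauss s w * perGauss s (w + (b - a))) a
    have h2 := hp.intervalIntegral_add_eq a 0
    simp only [zero_add, add_comm 1 a] at h1 h2
    rw [← h2, ← h1]
    refine intervalIntegral.integral_congr fun w _ => ?_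
    rw [show w + a + (b - a) = w + b by ring]
  have hi : ∀ a b : ℝ, IntervalIntegrable
      (fun w => perGauss s (w + a) * perGauss s (w + b)) volume 0 1 := fun a b =>
    ((hc.comp (continuous_add_const a)).mul
      (hc.comp (continuous_add_const b))).intervalIntegrable _ _
  have hexp : ∀ w : ℝ, (perGauss s (w - y) - perGauss s (w + y)) ^ 2 =
      perGauss s (w + -y) * perGauss s (w + -y) + perGauss s (w + y) * perGauss s (w + y) -
        2 * (perGauss s (w + -y) * perGauss s (w + y)) := fun w => by
    rw [← sub_eq_add_neg]
    ring
  simp_rw [hexp]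
  rw [intervalIntegral.integral_sub ((hi _ _).add (hi _ _)) ((hi _ _).const_mul 2),
    intervalIntegral.integral_add (hi _ _) (hi _ _), intervalIntegral.integral_const_mul,
    key, key, key]
  simp only [sub_self, sub_neg_eq_add]
  ring_nf

lemma rhoTilde_eq {ρ : ℝ} (hρ : 0 < ρ) (x y : ℝ) :
    rhoTilde ρ x y =
      (√(4 * π * ρ))⁻¹ * (perGauss ρ (y / 2 - x / 2) - perGauss ρ (y / 2 + x / 2)) := by
  unfold rhoTilde perGauss
  rw [← (summable_perGauss hρ _).tsum_sub (summable_perGauss hρ _)]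
  congr 1
  refine tsum_congr fun n => ?_
  congr 2 <;> field_simp <;> ring

lemma rhoTilde_comm {ρ : ℝ} (hρ : 0 < ρ) (x y : ℝ) : rhoTilde ρ x y = rhoTilde ρ y x := by
  rw [rhoTilde_eq hρ, rhoTilde_eq hρ, ← perGauss_neg ρ (y / 2 - x / 2), neg_sub,
    add_comm (y / 2)]

/-- The semigroup property on the diagonal. -/
lemma sqrt_mul_covK_self {ρ : ℝ} (hρ : 0 < ρ) (x : ℝ) :
    √(8 * π * ρ) * covK ρ x x = perGauss (2 * ρ) 0 - perGauss (2 * ρ) x := by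
  set F : ℝ → ℝ := fun w => (perGauss ρ (w - x / 2) - perGauss ρ (w + x / 2)) ^ 2 with hF
  have hc := continuous_perGauss hρ
  have hFc : Continuous F := by
    rw [hF]
    fun_prop
  have hFp : Function.Periodic F 1 := fun w => by
    simp only [hF]
    rw [show w + 1 - x / 2 = w - x / 2 + 1 by ring, show w + 1 + x / 2 = w + x / 2 + 1 by ring,
      perGauss_periodic ρ, perGauss_periodic ρ]
  have hFe : ∀ w, F (-w) = F w := fun w => by
    simp only [hF]
    rw [← perGauss_neg ρ (-w - x / 2), ← perGauss_neg ρ (-w + x / 2),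
      show -(-w - x / 2) = w + x / 2 by ring, show -(-w + x / 2) = w - x / 2 by ring]
    ring
  have hhalf : ∫ w in (0 : ℝ)..1, F w = 2 * ∫ w in (0 : ℝ)..(1 / 2), F w := by
    have h1 := hFp.intervalIntegral_add_eq 0 (-(1 / 2))
    have h2 := intervalIntegral.integral_comp_neg (a := 0) (b := 1 / 2) F
    simp only [hFe, neg_zero] at h2
    rw [zero_add, show -(1 / 2 : ℝ) + 1 = 1 / 2 by norm_num] at h1
    rw [h1, ← intervalIntegral.integral_add_adjacent_intervals
      (hFc.intervalIntegrable (-(1 / 2)) 0) (hFc.intervalIntegrable 0 (1 / 2)), ← h2]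
    ring
  have hK : covK ρ x x = (4 * π * ρ)⁻¹ * ∫ w in (0 : ℝ)..1, F w := by
    have h1 := intervalIntegral.integral_comp_div (a := 0) (b := 1) F (two_ne_zero' ℝ)
    rw [zero_div, smul_eq_mul, ← hhalf] at h1
    rw [← h1, ← intervalIntegral.integral_const_mul]
    refine intervalIntegral.integral_congr fun z _ => ?_
    rw [rhoTilde_comm hρ z x, rhoTilde_eq hρ, ← sq, mul_pow, inv_pow,
      Real.sq_sqrt (by positivity)]
  rw [hK, integral_perGauss_sub_sq hρ]
  have hs : √(8 * π * ρ) * √(π * ρ / 2) = 2 * π * ρ := by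
    rw [← Real.sqrt_mul (by positivity), show 8 * π * ρ * (π * ρ / 2) = (2 * π * ρ) ^ 2 by ring,
      Real.sqrt_sq (by positivity)]
  rw [show 2 * (x / 2) = x by ring]
  calc √(8 * π * ρ) * ((4 * π * ρ)⁻¹ *
        (2 * √(π * ρ / 2) * (perGauss (2 * ρ) 0 - perGauss (2 * ρ) x)))
      = (√(8 * π * ρ) * √(π * ρ / 2)) * (2 * (4 * π * ρ)⁻¹) *
        (perGauss (2 * ρ) 0 - perGauss (2 * ρ) x) := by ring
    _ = perGauss (2 * ρ) 0 - perGauss (2 * ρ) x := by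
      rw [hs]
      field_simp
      ring

lemma one_le_perGauss_zero {s : ℝ} (hs : 0 < s) : 1 ≤ perGauss s 0 := by
  simpa [perGauss] using (summable_perGauss hs 0).le_tsum 0 fun _ _ => (Real.exp_pos _).le

lemma perGauss_zero_le {s : ℝ} (hs : 0 < s) : perGauss s 0 ≤ 1 + s * (π ^ 2 / 3) := by
  refine hasSum_le (fun n => ?_) (summable_perGauss hs 0).hasSum
    ((hasSum_ite_eq (0 : ℤ) (1 : ℝ)).add (hasSum_int_one_div_sq.mul_left s))
  by_cases hn : n = 0
  · simp [hn]
  · simpa [hn] using exp_neg_sq_div_le hs (Int.cast_ne_zero.2 hn)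

lemma hasSum_nat_exp_le {s t : ℝ} (hs : 0 < s) (ht : 0 < t) {S : ℝ}
    (hS : HasSum (fun n : ℕ => Real.exp (-((n : ℝ) + t) ^ 2 / s)) S) :
    S ≤ s * (1 / t ^ 2) + s * (π ^ 2 / 6) := by
  refine hasSum_le (fun n => ?_) hS
    ((hasSum_ite_eq (0 : ℕ) (s * (1 / t ^ 2))).add (hasSum_zeta_two.mul_left s))
  by_cases hn : n = 0
  · simpa [hn] using exp_neg_sq_div_le hs ht.ne'
  · have hn' : (0 : ℝ) < n := by exact_mod_cast Nat.pos_of_ne_zero hn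
    simp only [hn, if_false, zero_add]
    refine (exp_neg_sq_div_le hs (by positivity)).trans ?_
    gcongr
    linarith

lemma perGauss_le {s x : ℝ} (hs : 0 < s) (hx : x ∈ Set.Ioo (0 : ℝ) 1) :
    perGauss s x ≤ s * (1 / x ^ 2 + 1 / (x - 1) ^ 2) + s * (π ^ 2 / 3) := by
  set f : ℤ → ℝ := fun n => Real.exp (-((n : ℝ) + x) ^ 2 / s) with hf
  have hsum : Summable f := summable_perGauss hs x
  have hpos : HasSum (fun n : ℕ => f n) _ := (hsum.comp_injective Nat.cast_injective).hasSum
  have hneg : HasSum (fun n : ℕ => f (-((n : ℤ) + 1))) _ := (hsum.comp_injective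
    (i := fun n : ℕ => -((n : ℤ) + 1)) (fun a b h => by simpa using h)).hasSum
  have htot : perGauss s x = _ := (hpos.of_nat_of_neg_add_one hneg).tsum_eq
  have hfpos : ∀ n : ℕ, f n = Real.exp (-((n : ℝ) + x) ^ 2 / s) := fun n => by simp [hf]
  have hfneg : ∀ n : ℕ, f (-((n : ℤ) + 1)) = Real.exp (-((n : ℝ) + (1 - x)) ^ 2 / s) :=
    fun n => by
      simp only [hf, Int.cast_neg, Int.cast_add, Int.cast_natCast, Int.cast_one]
      ring_nf
  have h1 := hasSum_nat_exp_le hs hx.1 (by simpa only [hfpos] using hpos)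
  have h2 := hasSum_nat_exp_le hs (sub_pos.2 hx.2) (by simpa only [hfneg] using hneg)
  rw [show (1 - x) ^ 2 = (x - 1) ^ 2 by ring] at h2
  rw [htot]
  linarith

/-- Diagonal estimate for 𝒦: |√(8πρ)·𝒦(x,x) − 1| ≤ C_x·ρ with
C_x = 2(1/x² + 1/(x−1)²) + 2π²/3, equivalently the two-sided bound on 𝒦(x,x). -/
theorem covK_diagonal_estimate (x : ℝ) (hx : x ∈ Set.Ioo (0 : ℝ) 1) (ρ : ℝ) (hρ : 0 < ρ) :
    |Real.sqrt (8 * π * ρ) * covK ρ x x - 1| ≤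
      2 * ρ * (1 / x ^ 2 + 1 / (x - 1) ^ 2) + (2 * π ^ 2 / 3) * ρ ∧
    (Real.sqrt (8 * π * ρ))⁻¹ -
        (2 * (1 / x ^ 2 + 1 / (x - 1) ^ 2) + 2 * π ^ 2 / 3) * Real.sqrt ρ / Real.sqrt (8 * π) ≤
      covK ρ x x ∧
    covK ρ x x ≤ (Real.sqrt (8 * π * ρ))⁻¹ +
        (2 * (1 / x ^ 2 + 1 / (x - 1) ^ 2) + 2 * π ^ 2 / 3) * Real.sqrt ρ / Real.sqrt (8 * π) := by
  have hD := sqrt_mul_covK_self hρ x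
  have hs : 0 < 2 * ρ := by positivity
  have habs : |√(8 * π * ρ) * covK ρ x x - 1| ≤
      2 * ρ * (1 / x ^ 2 + 1 / (x - 1) ^ 2) + (2 * π ^ 2 / 3) * ρ := by
    have hC : 0 ≤ 2 * ρ * (1 / x ^ 2 + 1 / (x - 1) ^ 2) := by positivity
    rw [hD, abs_le]
    constructor <;>
      linarith [one_le_perGauss_zero hs, perGauss_zero_le hs, perGauss_le hs hx,
        perGauss_nonneg (2 * ρ) x]
  have hr : 0 < √ρ := Real.sqrt_pos.2 hρ
  have h8 : 0 < √(8 * π) := Real.sqrt_pos.2 (by positivity)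
  have hsplit : √(8 * π * ρ) = √(8 * π) * √ρ := Real.sqrt_mul (by positivity) ρ
  have hρ' : √ρ * √ρ = ρ := Real.mul_self_sqrt hρ.le
  set C := 2 * (1 / x ^ 2 + 1 / (x - 1) ^ 2) + 2 * π ^ 2 / 3 with hC
  have hCρ : 2 * ρ * (1 / x ^ 2 + 1 / (x - 1) ^ 2) + (2 * π ^ 2 / 3) * ρ = C * ρ := by
    rw [hC]
    ring
  have hterm : C * √ρ / √(8 * π) = (C * ρ) / √(8 * π * ρ) := by
    rw [hsplit, ← hρ']
    field_simp
    rw [Real.sqrt_sq hr.le]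
  have hpos : 0 < √(8 * π * ρ) := Real.sqrt_pos.2 (by positivity)
  refine ⟨habs, ?_, ?_⟩ <;> rw [hCρ, abs_le] at habs
  · rw [hterm, inv_eq_one_div, ← sub_div, div_le_iff₀ hpos]
    linarith
  · rw [hterm, inv_eq_one_div, ← add_div, le_div_iff₀ hpos]
    linarith
end

section
/- Let n ≥ 1 be an integer, ρ > 0, and let x₁,…,xₙ ∈ (0,1) be pairwise distinct. For each i define C_{x_i} := 2·(1/x_i² + 1/(x_i−1)²) + 2π²/3 and Ĉ_{x_i} := C_{x_i}/√(8π) + Σ_{j≠i} √(8/π)/(x_j − x_i)² + (√2·π^{3/2}/6)·(n−1). Then for every i: 𝒦(x_i,x_i) + Σ_{j≠i} |𝒦(x_i,x_j)| ≤ (8πρ)^{−1/2} + Ĉ_{x_i}·√ρ, and 𝒦(x_i,x_i) − Σ_{j≠i} |𝒦(x_i,x_j)| ≥ (8πρ)^{−1/2} − Ĉ_{x_i}·√ρ. -/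
open Real

/-- The constant C_x := 2(1/x² + 1/(x−1)²) + 2π²/3. -/
noncomputable def Cconst (x : ℝ) : ℝ := 2 * (1 / x ^ 2 + 1 / (x - 1) ^ 2) + 2 * π ^ 2 / 3

/-- The constant Ĉ_{x_i}. -/
noncomputable def ChatConst (n : ℕ) (x : Fin n → ℝ) (i : Fin n) : ℝ :=
  Cconst (x i) / Real.sqrt (8 * π) +
    (∑ j ∈ Finset.univ.erase i, Real.sqrt (8 / π) / (x j - x i) ^ 2) +
    (Real.sqrt 2 * π ^ ((3 : ℝ) / 2) / 6) * ((n : ℝ) - 1)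

open MeasureTheory

/-- The periodized Gaussian `∑ₙ exp (-a (n + u)²)`. -/
noncomputable def gaussTheta (a u : ℝ) : ℝ := ∑' n : ℤ, Real.exp (-a * ((n : ℝ) + u) ^ 2)

lemma hasSum_gaussTheta_evenKernel {a : ℝ} (ha : 0 < a) (u : ℝ) :
    HasSum (fun n : ℤ => Real.exp (-a * ((n : ℝ) + u) ^ 2))
      (HurwitzZeta.evenKernel (u : UnitAddCircle) (a / π)) := by
  convert HurwitzZeta.hasSum_int_evenKernel u (div_pos ha pi_pos) using 3
  field_simp

lemma gaussTheta_eq_evenKernel {a : ℝ} (ha : 0 < a) (u : ℝ) :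
    gaussTheta a u = HurwitzZeta.evenKernel (u : UnitAddCircle) (a / π) :=
  (hasSum_gaussTheta_evenKernel ha u).tsum_eq

lemma hasSum_gaussTheta {a : ℝ} (ha : 0 < a) (u : ℝ) :
    HasSum (fun n : ℤ => Real.exp (-a * ((n : ℝ) + u) ^ 2)) (gaussTheta a u) :=
  (hasSum_gaussTheta_evenKernel ha u).summable.hasSum

lemma gaussTheta_neg {a : ℝ} (ha : 0 < a) (u : ℝ) : gaussTheta a (-u) = gaussTheta a u := by
  simp only [gaussTheta_eq_evenKernel ha, AddCircle.coe_neg, HurwitzZeta.evenKernel_neg]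

lemma gaussTheta_periodic {a : ℝ} (ha : 0 < a) : Function.Periodic (gaussTheta a) 1 := by
  intro u
  simp only [gaussTheta_eq_evenKernel ha, AddCircle.coe_add_period]

lemma gaussTheta_nonneg (a u : ℝ) : 0 ≤ gaussTheta a u :=
  tsum_nonneg fun _ => (Real.exp_pos _).le

lemma continuous_gaussTheta {a : ℝ} (ha : 0 < a) : Continuous (gaussTheta a) := by
  have hpos : 0 < (Complex.I * ((a / π : ℝ) : ℂ)).im := by
    simpa using div_pos ha pi_pos
  have hJ : Continuous fun z : ℂ => jacobiTheta₂ z (Complex.I * ((a / π : ℝ) : ℂ)) :=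
    continuous_iff_continuousAt.2 fun z =>
      (differentiableAt_jacobiTheta₂_fst z hpos).continuousAt
  have hC : Continuous fun u : ℝ => ((gaussTheta a u : ℝ) : ℂ) := by
    simp only [gaussTheta_eq_evenKernel ha, HurwitzZeta.evenKernel_def]
    exact (by fun_prop : Continuous fun u : ℝ =>
      Complex.exp (-(π : ℂ) * (u : ℂ) ^ 2 * ((a / π : ℝ) : ℂ))).mul (hJ.comp (by fun_prop))
  exact Complex.continuous_re.comp hC

lemma exists_gaussTheta_le {a : ℝ} (ha : 0 < a) : ∃ C, ∀ u, gaussTheta a u ≤ C := by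
  obtain ⟨C, hC⟩ := isCompact_Icc.exists_bound_of_continuousOn
    (continuous_gaussTheta ha).continuousOn (s := Set.Icc (0 : ℝ) 1)
  refine ⟨C, fun u => ?_⟩
  obtain ⟨y, hy, hyu⟩ := (gaussTheta_periodic ha).exists_mem_Ico₀ one_pos u
  rw [hyu]
  exact (le_abs_self _).trans (hC y ⟨hy.1, hy.2.le⟩)

lemma integral_gaussian_mul_gaussian (a v : ℝ) :
    ∫ w : ℝ, Real.exp (-a * w ^ 2) * Real.exp (-a * (v - w) ^ 2) =
      √(π / (2 * a)) * Real.exp (-(a / 2) * v ^ 2) := by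
  have h : ∀ w : ℝ, Real.exp (-a * w ^ 2) * Real.exp (-a * (v - w) ^ 2) =
      Real.exp (-(2 * a) * (w - v / 2) ^ 2) * Real.exp (-(a / 2) * v ^ 2) := by
    intro w
    rw [← Real.exp_add, ← Real.exp_add]
    ring_nf
  simp_rw [h]
  rw [integral_mul_const, integral_sub_right_eq_self (fun w => Real.exp (-(2 * a) * w ^ 2)),
    integral_gaussian]

lemma integrable_gaussian_mul {a : ℝ} (ha : 0 < a) {g : ℝ → ℝ} (hg : Continuous g) {C : ℝ}
    (hC : ∀ w, |g w| ≤ C) : Integrable fun w : ℝ => Real.exp (-a * w ^ 2) * g w := by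
  simp_rw [mul_comm (Real.exp _)]
  exact (integrable_exp_neg_mul_sq ha).bdd_mul hg.aestronglyMeasurable
    (Filter.Eventually.of_forall hC)

/-- Unfolding: pairing a periodized Gaussian with a periodic function over one period is the
integral over the whole line against a Gaussian. -/
lemma integral_gaussTheta_mul {a : ℝ} (ha : 0 < a) {g : ℝ → ℝ} (hg : Continuous g) {C : ℝ}
    (hC : ∀ w, |g w| ≤ C) (hg0 : ∀ w, 0 ≤ g w) (hper : Function.Periodic g 1) :
    ∫ w in (0 : ℝ)..1, gaussTheta a w * g w = ∫ w : ℝ, Real.exp (-a * w ^ 2) * g w := by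
  have hsum := (integrable_gaussian_mul ha hg hC).hasSum_intervalIntegral_comp_add_int
  have hterm : ∀ (n : ℤ) (w : ℝ), Real.exp (-a * (w + n) ^ 2) * g (w + n) =
      Real.exp (-a * ((n : ℝ) + w) ^ 2) * g w := by
    intro n w
    have := hper.int_mul n w
    rw [mul_one] at this
    rw [this, add_comm]
  simp_rw [hterm, intervalIntegral.integral_of_le zero_le_one] at hsum
  rw [← hsum.tsum_eq, intervalIntegral.integral_of_le zero_le_one]
  have hnorm : ∀ (n : ℤ) (w : ℝ), ‖Real.exp (-a * ((n : ℝ) + w) ^ 2) * g w‖ =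
      Real.exp (-a * ((n : ℝ) + w) ^ 2) * g w := fun n w =>
    Real.norm_of_nonneg (mul_nonneg (Real.exp_pos _).le (hg0 w))
  rw [integral_tsum_of_summable_integral_norm]
  · simp_rw [gaussTheta, tsum_mul_right]
  · intro n
    exact (by fun_prop : Continuous fun w : ℝ =>
      Real.exp (-a * ((n : ℝ) + w) ^ 2) * g w).integrableOn_Ioc
  · simp_rw [hnorm]
    exact hsum.summable

lemma integral_gaussTheta_mul_gaussTheta {a : ℝ} (ha : 0 < a) (u : ℝ) :
    ∫ w in (0 : ℝ)..1, gaussTheta a w * gaussTheta a (u - w) =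
      √(π / (2 * a)) * gaussTheta (a / 2) u := by
  obtain ⟨C, hC⟩ := exists_gaussTheta_le ha
  have hcont : Continuous fun w => gaussTheta a (u - w) :=
    (continuous_gaussTheta ha).comp (by fun_prop)
  rw [integral_gaussTheta_mul ha hcont
    (fun w => (abs_of_nonneg (gaussTheta_nonneg a _)).trans_le (hC (u - w)))
    (fun w => gaussTheta_nonneg a _)
    (fun w => by rw [← gaussTheta_periodic ha]; congr 1; ring)]
  have hnorm : ∀ (n : ℤ) (w : ℝ),
      ‖Real.exp (-a * w ^ 2) * Real.exp (-a * ((n : ℝ) + u - w) ^ 2)‖ =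
      Real.exp (-a * w ^ 2) * Real.exp (-a * ((n : ℝ) + u - w) ^ 2) := fun n w =>
    Real.norm_of_nonneg (by positivity)
  have hs := (hasSum_gaussTheta (half_pos ha) u).mul_left √(π / (2 * a))
  rw [← hs.tsum_eq]
  simp_rw [← integral_gaussian_mul_gaussian]
  rw [integral_tsum_of_summable_integral_norm]
  · simp_rw [gaussTheta, tsum_mul_left, add_sub_assoc]
  · intro n
    refine integrable_gaussian_mul (C := 1) ha (by fun_prop) fun w => ?_
    rw [abs_of_pos (Real.exp_pos _), Real.exp_le_one_iff]
    nlinarith [mul_nonneg ha.le (sq_nonneg ((n : ℝ) + u - w))]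
  · simp_rw [hnorm, integral_gaussian_mul_gaussian]
    exact hs.summable

lemma integral_gaussTheta_add_mul_gaussTheta_sub {a : ℝ} (ha : 0 < a) (p q : ℝ) :
    ∫ w in (0 : ℝ)..1, gaussTheta a (w + p) * gaussTheta a (q - w) =
      √(π / (2 * a)) * gaussTheta (a / 2) (q + p) := by
  rw [← integral_gaussTheta_mul_gaussTheta ha]
  have hper : Function.Periodic
      (fun w => gaussTheta a w * gaussTheta a (q + p - w)) 1 := by
    intro w
    have h1 := gaussTheta_periodic ha w
    have h2 := gaussTheta_periodic ha (q + p - (w + 1))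
    rw [show q + p - (w + 1) + 1 = q + p - w by ring] at h2
    simp only [h1, h2]
  have h := hper.intervalIntegral_add_eq p 0
  rw [zero_add] at h
  rw [← h]
  have h' := intervalIntegral.integral_comp_add_right (a := 0) (b := 1)
    (fun w => gaussTheta a w * gaussTheta a (q + p - w)) p
  rw [zero_add, add_comm 1 p] at h'
  rw [← h']
  refine intervalIntegral.integral_congr fun w _ => ?_
  rw [add_sub_add_right_eq_sub]

lemma integral_reflected_gaussTheta {a : ℝ} (ha : 0 < a) (p q : ℝ) :
    ∫ w in (0 : ℝ)..1, (gaussTheta a (w - p) - gaussTheta a (w + p)) *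
        (gaussTheta a (q - w) - gaussTheta a (q + w)) =
      2 * √(π / (2 * a)) * (gaussTheta (a / 2) (q - p) - gaussTheta (a / 2) (q + p)) := by
  have hc := continuous_gaussTheta ha
  have hI : ∀ r s : ℝ, IntervalIntegrable
      (fun w => gaussTheta a (w + r) * gaussTheta a (s - w)) volume 0 1 := fun r s =>
    ((hc.comp (by fun_prop)).mul (hc.comp (by fun_prop))).intervalIntegrable _ _
  have hsplit : ∀ w, (gaussTheta a (w - p) - gaussTheta a (w + p)) *
        (gaussTheta a (q - w) - gaussTheta a (q + w)) =
      (gaussTheta a (w + -p) * gaussTheta a (q - w) -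
        gaussTheta a (w + -p) * gaussTheta a (-q - w)) -
      (gaussTheta a (w + p) * gaussTheta a (q - w) -
        gaussTheta a (w + p) * gaussTheta a (-q - w)) := by
    intro w
    rw [← gaussTheta_neg ha (q + w), neg_add', ← sub_eq_add_neg]
    ring
  simp_rw [hsplit]
  rw [intervalIntegral.integral_sub ((hI _ _).sub (hI _ _)) ((hI _ _).sub (hI _ _)),
    intervalIntegral.integral_sub (hI _ _) (hI _ _),
    intervalIntegral.integral_sub (hI _ _) (hI _ _)]
  simp_rw [integral_gaussTheta_add_mul_gaussTheta_sub ha]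
  rw [← gaussTheta_neg (half_pos ha) (-q + -p), ← gaussTheta_neg (half_pos ha) (-q + p),
    show -(-q + -p) = q + p by ring, show -(-q + p) = q - p by ring, ← sub_eq_add_neg]
  ring

lemma integral_half_reflected_gaussTheta {a : ℝ} (ha : 0 < a) (p q : ℝ) :
    2 * ∫ w in (0 : ℝ)..(1 / 2), (gaussTheta a (w - p) - gaussTheta a (w + p)) *
        (gaussTheta a (q - w) - gaussTheta a (q + w)) =
      2 * √(π / (2 * a)) * (gaussTheta (a / 2) (q - p) - gaussTheta (a / 2) (q + p)) := by
  rw [← integral_reflected_gaussTheta ha]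
  set Q : ℝ → ℝ := fun w => (gaussTheta a (w - p) - gaussTheta a (w + p)) *
    (gaussTheta a (q - w) - gaussTheta a (q + w)) with hQ
  have hc := continuous_gaussTheta ha
  have hQc : Continuous Q := by fun_prop
  have hsymm : ∀ w, Q (1 - w) = Q w := by
    intro w
    have hp := gaussTheta_periodic ha
    have h1 : gaussTheta a (1 - w - p) = gaussTheta a (w + p) := by
      rw [← gaussTheta_neg ha (w + p), ← hp (-(w + p))]; congr 1; ring
    have h2 : gaussTheta a (1 - w + p) = gaussTheta a (w - p) := by
      rw [← gaussTheta_neg ha (w - p), ← hp (-(w - p))]; congr 1; ring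
    have h3 : gaussTheta a (q - (1 - w)) = gaussTheta a (q + w) := by
      rw [← hp]; congr 1; ring
    have h4 : gaussTheta a (q + (1 - w)) = gaussTheta a (q - w) := by
      rw [← hp (q - w)]; congr 1; ring
    simp only [hQ, h1, h2, h3, h4]
    ring
  have hrefl : ∫ w in (1 / 2 : ℝ)..1, Q w = ∫ w in (0 : ℝ)..(1 / 2), Q w := by
    have h := intervalIntegral.integral_comp_sub_left (a := 0) (b := 1 / 2) Q 1
    simp_rw [hsymm] at h
    rw [h]
    norm_num
  rw [← intervalIntegral.integral_add_adjacent_intervals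
    (hQc.intervalIntegrable 0 (1 / 2)) (hQc.intervalIntegrable (1 / 2) 1), hrefl, two_mul]

lemma rhoTilde_eq_gaussTheta {ρ : ℝ} (hρ : 0 < ρ) (x y : ℝ) :
    rhoTilde ρ x y = (√(4 * π * ρ))⁻¹ *
      (gaussTheta (1 / ρ) (y / 2 - x / 2) - gaussTheta (1 / ρ) (y / 2 + x / 2)) := by
  have ha : 0 < 1 / ρ := by positivity
  rw [rhoTilde, ← ((hasSum_gaussTheta ha (y / 2 - x / 2)).sub
    (hasSum_gaussTheta ha (y / 2 + x / 2))).tsum_eq]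
  congr 1
  refine tsum_congr fun n => ?_
  congr 2 <;> field_simp <;> ring

/-- The semigroup identity `𝒦 = ρ̃` at time `2ρ`, in terms of periodized Gaussians. -/
lemma covK_eq_gaussTheta {ρ : ℝ} (hρ : 0 < ρ) (x y : ℝ) :
    covK ρ x y = (√(8 * π * ρ))⁻¹ *
      (gaussTheta (1 / (2 * ρ)) ((y - x) / 2) - gaussTheta (1 / (2 * ρ)) ((y + x) / 2)) := by
  have ha : 0 < 1 / ρ := by positivity
  have hπ := pi_pos
  have hcomp := intervalIntegral.integral_comp_div (a := 0) (b := 1) (c := 2)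
    (fun w => (gaussTheta (1 / ρ) (w - x / 2) - gaussTheta (1 / ρ) (w + x / 2)) *
        (gaussTheta (1 / ρ) (y / 2 - w) - gaussTheta (1 / ρ) (y / 2 + w))) two_ne_zero
  rw [zero_div, smul_eq_mul, integral_half_reflected_gaussTheta ha] at hcomp
  have hprod : ∀ z, rhoTilde ρ x z * rhoTilde ρ z y = (4 * π * ρ)⁻¹ *
      ((gaussTheta (1 / ρ) (z / 2 - x / 2) - gaussTheta (1 / ρ) (z / 2 + x / 2)) *
        (gaussTheta (1 / ρ) (y / 2 - z / 2) - gaussTheta (1 / ρ) (y / 2 + z / 2))) := by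
    intro z
    rw [rhoTilde_eq_gaussTheta hρ, rhoTilde_eq_gaussTheta hρ, mul_mul_mul_comm, ← mul_inv,
      Real.mul_self_sqrt (by positivity)]
  have hconst : (4 * π * ρ)⁻¹ * (2 * √(π / (2 * (1 / ρ)))) = (√(8 * π * ρ))⁻¹ := by
    have h1 : √(π / (2 * (1 / ρ))) = √(8 * π * ρ) / 4 := by
      rw [show π / (2 * (1 / ρ)) = 8 * π * ρ / 4 ^ 2 by field_simp; norm_num,
        Real.sqrt_div (by positivity), Real.sqrt_sq (by norm_num)]
    have h3 : √(8 * π * ρ) ^ 2 = 8 * π * ρ := Real.sq_sqrt (by positivity)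
    rw [h1]
    refine eq_inv_of_mul_eq_one_left ?_
    calc (4 * π * ρ)⁻¹ * (2 * (√(8 * π * ρ) / 4)) * √(8 * π * ρ)
        = (4 * π * ρ)⁻¹ * (√(8 * π * ρ) ^ 2 / 2) := by ring
      _ = 1 := by rw [h3]; field_simp; norm_num
  simp_rw [covK, hprod]
  rw [intervalIntegral.integral_const_mul, hcomp, ← mul_assoc, hconst, ← sub_div, ← add_div,
    show 1 / ρ / 2 = 1 / (2 * ρ) by field_simp]

lemma exp_neg_mul_sq_le {b t : ℝ} (hb : 0 < b) (ht : t ≠ 0) :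
    Real.exp (-b * t ^ 2) ≤ (2 * b)⁻¹ * (1 / t ^ 2) := by
  have ht2 : 0 < t ^ 2 := by positivity
  have hv : 0 < b * t ^ 2 := by positivity
  have h : 2 * (b * t ^ 2) ≤ Real.exp (b * t ^ 2) := by
    nlinarith [Real.quadratic_le_exp_of_nonneg hv.le, sq_nonneg (b * t ^ 2 - 1)]
  rw [neg_mul, Real.exp_neg]
  calc (Real.exp (b * t ^ 2))⁻¹ ≤ (2 * (b * t ^ 2))⁻¹ := by gcongr
    _ = (2 * b)⁻¹ * (1 / t ^ 2) := by field_simp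

lemma exp_neg_mul_nat_add_sq_le {b F t : ℝ} (hb : 0 < b) (ht : 0 ≤ t)
    (hF : Real.exp (-b * t ^ 2) ≤ F) (m : ℕ) :
    Real.exp (-b * ((m : ℝ) + t) ^ 2) ≤
      (if m = 0 then F else 0) + (2 * b)⁻¹ * (1 / (m : ℝ) ^ 2) := by
  rcases Nat.eq_zero_or_pos m with rfl | hm
  · simpa using hF
  · rw [if_neg hm.ne', zero_add]
    have hm' : (0 : ℝ) < m := by exact_mod_cast hm
    refine le_trans (Real.exp_le_exp.2 ?_) (exp_neg_mul_sq_le hb hm'.ne')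
    have h : (m : ℝ) ^ 2 ≤ ((m : ℝ) + t) ^ 2 := by gcongr; linarith
    have := mul_le_mul_of_nonneg_left h hb.le
    linarith

lemma tsum_exp_neg_mul_nat_add_sq_le {b F t : ℝ} (hb : 0 < b) (ht : 0 ≤ t)
    (hF : Real.exp (-b * t ^ 2) ≤ F) :
    ∑' m : ℕ, Real.exp (-b * ((m : ℝ) + t) ^ 2) ≤ F + (2 * b)⁻¹ * (π ^ 2 / 6) := by
  have hmaj : HasSum
      (fun m : ℕ => (if m = 0 then F else 0) + (2 * b)⁻¹ * (1 / (m : ℝ) ^ 2))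
      (F + (2 * b)⁻¹ * (π ^ 2 / 6)) :=
    (hasSum_ite_eq 0 F).add (hasSum_zeta_two.mul_left _)
  have hs : Summable fun m : ℕ => Real.exp (-b * ((m : ℝ) + t) ^ 2) :=
    Summable.of_nonneg_of_le (fun _ => (Real.exp_pos _).le)
      (exp_neg_mul_nat_add_sq_le hb ht hF) hmaj.summable
  rw [← hmaj.tsum_eq]
  exact hs.tsum_le_tsum (exp_neg_mul_nat_add_sq_le hb ht hF) hmaj.summable

lemma gaussTheta_le {b u E E' : ℝ} (hb : 0 < b) (hu0 : 0 ≤ u) (hu1 : u ≤ 1)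
    (hE : Real.exp (-b * u ^ 2) ≤ E) (hE' : Real.exp (-b * (1 - u) ^ 2) ≤ E') :
    gaussTheta b u ≤ E + E' + (2 * b)⁻¹ * (π ^ 2 / 3) := by
  have hs := (hasSum_gaussTheta hb u).summable
  set f : ℤ → ℝ := fun n => Real.exp (-b * ((n : ℝ) + u) ^ 2) with hf
  have hpos : ∀ m : ℕ, f m = Real.exp (-b * ((m : ℝ) + u) ^ 2) := by
    intro m
    rw [hf]
    simp only [Int.cast_natCast]
  have hneg : ∀ m : ℕ, f (-((m : ℤ) + 1)) = Real.exp (-b * ((m : ℝ) + (1 - u)) ^ 2) := by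
    intro m
    rw [hf]
    push_cast
    ring_nf
  have hs1 : Summable fun m : ℕ => f m := hs.comp_injective Nat.cast_injective
  have hs2 : Summable fun m : ℕ => f (-((m : ℤ) + 1)) :=
    hs.comp_injective fun m k (h : -((m : ℤ) + 1) = -((k : ℤ) + 1)) => by lia
  have hsplit : gaussTheta b u = ∑' m : ℕ, f m + ∑' m : ℕ, f (-((m : ℤ) + 1)) :=
    tsum_of_nat_of_neg_add_one hs1 hs2
  rw [hsplit, tsum_congr hpos, tsum_congr hneg]
  have h1 := tsum_exp_neg_mul_nat_add_sq_le hb hu0 hE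
  have h2 := tsum_exp_neg_mul_nat_add_sq_le hb (sub_nonneg.2 hu1) hE'
  linarith

lemma gaussTheta_le_of_mem_Ioo {b u : ℝ} (hb : 0 < b) (hu : u ∈ Set.Ioo (0 : ℝ) 1) :
    gaussTheta b u ≤ (2 * b)⁻¹ * (1 / u ^ 2 + 1 / (1 - u) ^ 2 + π ^ 2 / 3) := by
  have h := gaussTheta_le hb hu.1.le hu.2.le (exp_neg_mul_sq_le hb hu.1.ne')
    (exp_neg_mul_sq_le hb (sub_pos.2 hu.2).ne')
  linarith

lemma one_le_gaussTheta_zero {b : ℝ} (hb : 0 < b) : 1 ≤ gaussTheta b 0 := by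
  simpa [gaussTheta] using (hasSum_gaussTheta hb 0).summable.le_tsum 0 fun _ _ => (Real.exp_pos _).le

lemma gaussTheta_zero_le {b : ℝ} (hb : 0 < b) :
    gaussTheta b 0 ≤ 1 + (2 * b)⁻¹ * (1 + π ^ 2 / 3) := by
  have h1 := exp_neg_mul_sq_le hb one_ne_zero
  have h := gaussTheta_le (E := 1) hb le_rfl zero_le_one (by simp) le_rfl
  rw [sub_zero] at h
  rw [one_pow, div_one, mul_one] at h1
  rw [one_pow, mul_one] at h
  linarith

lemma gaussTheta_le_of_dist {b u δ : ℝ} (hb : 0 < b) (hδ : 0 < δ) (h0 : δ ≤ u) (h1 : u ≤ 1 - δ) :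
    gaussTheta b u ≤ (2 * b)⁻¹ * (2 / δ ^ 2 + π ^ 2 / 3) := by
  refine (gaussTheta_le_of_mem_Ioo hb ⟨by linarith, by linarith⟩).trans ?_
  have hu : 1 / u ^ 2 ≤ 1 / δ ^ 2 := by gcongr
  have hu' : 1 / (1 - u) ^ 2 ≤ 1 / δ ^ 2 := by gcongr; linarith
  have hb' : 0 < (2 * b)⁻¹ := by positivity
  gcongr
  rw [show 2 / δ ^ 2 = 1 / δ ^ 2 + 1 / δ ^ 2 by ring]
  linarith

lemma inv_sqrt_mul_self {ρ : ℝ} (hρ : 0 < ρ) :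
    (√(8 * π * ρ))⁻¹ * ρ = √ρ / √(8 * π) := by
  have hπ := pi_pos
  have h1 : √ρ ≠ 0 := by positivity
  have h2 : √(8 * π) ≠ 0 := by positivity
  rw [Real.sqrt_mul (by positivity)]
  field_simp
  rw [Real.sq_sqrt hρ.le]

lemma abs_covK_self_sub_le {ρ x : ℝ} (hρ : 0 < ρ) (hx : x ∈ Set.Ioo (0 : ℝ) 1) :
    |covK ρ x x - (√(8 * π * ρ))⁻¹| ≤ Cconst x / √(8 * π) * √ρ := by
  have hb : 0 < 1 / (2 * ρ) := by positivity
  have hbρ : (2 * (1 / (2 * ρ)))⁻¹ = ρ := by field_simp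
  have hA := one_le_gaussTheta_zero hb
  have hA' := gaussTheta_zero_le hb
  have hB := gaussTheta_nonneg (1 / (2 * ρ)) x
  have hB' := gaussTheta_le_of_mem_Ioo hb hx
  rw [hbρ] at hA' hB'
  rw [covK_eq_gaussTheta hρ, sub_self, zero_div, add_self_div_two, ← mul_sub_one, abs_mul,
    abs_of_nonneg (by positivity : 0 ≤ (√(8 * π * ρ))⁻¹)]
  have hR : Cconst x / √(8 * π) * √ρ = (√(8 * π * ρ))⁻¹ * (ρ * Cconst x) := by
    rw [← mul_assoc, inv_sqrt_mul_self hρ]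
    ring
  rw [hR]
  gcongr
  have hx2 : 0 ≤ 1 / x ^ 2 := by positivity
  have hx3 : 0 ≤ 1 / (x - 1) ^ 2 := by positivity
  rw [show (1 - x) ^ 2 = (x - 1) ^ 2 by ring] at hB'
  have hπ : 3 ≤ π ^ 2 := by nlinarith [pi_gt_three]
  have hC1 : ρ * (1 + π ^ 2 / 3) ≤ ρ * Cconst x := by
    gcongr
    rw [Cconst]
    linarith
  have hC2 : ρ * (1 / x ^ 2 + 1 / (x - 1) ^ 2 + π ^ 2 / 3) ≤ ρ * Cconst x := by
    gcongr
    rw [Cconst]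
    linarith
  rw [abs_le]
  constructor <;> linarith

lemma abs_covK_le {ρ x y : ℝ} (hρ : 0 < ρ) (hx : x ∈ Set.Ioo (0 : ℝ) 1)
    (hy : y ∈ Set.Ioo (0 : ℝ) 1) (hxy : y ≠ x) :
    |covK ρ x y| ≤ (√(8 / π) / (y - x) ^ 2 + √2 * π ^ ((3 : ℝ) / 2) / 6) * √ρ := by
  have hb : 0 < 1 / (2 * ρ) := by positivity
  have hbρ : (2 * (1 / (2 * ρ)))⁻¹ = ρ := by field_simp
  have hπ := pi_pos
  have hd : 0 < |y - x| := abs_pos.2 (sub_ne_zero.2 hxy)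
  obtain ⟨hx0, hx1⟩ := hx
  obtain ⟨hy0, hy1⟩ := hy
  have hdlt : |y - x| < 1 := abs_lt.2 ⟨by linarith, by linarith⟩
  have hds : |y - x| ≤ y + x := abs_le.2 ⟨by linarith, by linarith⟩
  have hds' : |y - x| ≤ 2 - (y + x) := abs_le.2 ⟨by linarith, by linarith⟩
  have hA : gaussTheta (1 / (2 * ρ)) ((y - x) / 2) =
      gaussTheta (1 / (2 * ρ)) (|y - x| / 2) := by
    rcases abs_choice (y - x) with h | h <;> rw [h]
    rw [neg_div, gaussTheta_neg hb]
  have hA' := gaussTheta_le_of_dist hb (half_pos hd) le_rfl (by linarith)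
  have hB' := gaussTheta_le_of_dist (u := (y + x) / 2) hb (half_pos hd)
    (by linarith) (by linarith)
  rw [← hA] at hA'
  have hA0 := gaussTheta_nonneg (1 / (2 * ρ)) ((y - x) / 2)
  have hB0 := gaussTheta_nonneg (1 / (2 * ρ)) ((y + x) / 2)
  rw [hbρ, div_pow, sq_abs] at hA' hB'
  rw [covK_eq_gaussTheta hρ, abs_mul, abs_of_nonneg (by positivity : 0 ≤ (√(8 * π * ρ))⁻¹)]
  have hsub : (y - x) ^ 2 ≠ 0 := pow_ne_zero _ (sub_ne_zero.2 hxy)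
  have h8 : √(8 / π) = 8 / √(8 * π) := by
    rw [show 8 / π = 8 ^ 2 / (8 * π) by field_simp, Real.sqrt_div (by positivity),
      Real.sqrt_sq (by norm_num)]
  have h2 : √2 * π ^ ((3 : ℝ) / 2) = 4 * π ^ 2 / √(8 * π) := by
    have hrp : π ^ ((3 : ℝ) / 2) = π * √π := by
      rw [show (3 : ℝ) / 2 = 1 + 1 / 2 by norm_num, Real.rpow_add hπ, Real.rpow_one,
        Real.sqrt_eq_rpow]
    have h4 : √(8 * π) = 2 * √2 * √π := by
      rw [show 8 * π = 2 ^ 2 * 2 * π by ring, Real.sqrt_mul (by positivity),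
        Real.sqrt_mul (by positivity), Real.sqrt_sq (by norm_num)]
    have h5 : √π ^ 2 = π := Real.sq_sqrt hπ.le
    have h6 : √2 ^ 2 = 2 := Real.sq_sqrt (by norm_num)
    rw [hrp, h4, eq_div_iff (by positivity)]
    calc √2 * (π * √π) * (2 * √2 * √π) = 2 * √2 ^ 2 * π * √π ^ 2 := by ring
      _ = 4 * π ^ 2 := by rw [h5, h6]; ring
  have hR : (√(8 / π) / (y - x) ^ 2 + √2 * π ^ ((3 : ℝ) / 2) / 6) * √ρ =
      (√(8 * π * ρ))⁻¹ * (ρ * (8 / (y - x) ^ 2 + 2 * π ^ 2 / 3)) := by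
    rw [← mul_assoc, inv_sqrt_mul_self hρ, h2, h8]
    ring
  rw [hR]
  gcongr
  have hle : ρ * (2 / ((y - x) ^ 2 / 2 ^ 2) + π ^ 2 / 3) ≤
      ρ * (8 / (y - x) ^ 2 + 2 * π ^ 2 / 3) := by
    gcongr ρ * ?_
    rw [show 2 / ((y - x) ^ 2 / 2 ^ 2) = 8 / (y - x) ^ 2 by field_simp; norm_num]
    nlinarith [sq_nonneg π]
  rw [abs_le]
  constructor <;> linarith

/-- Row-sum bounds for the covariance matrix 𝒦(x_i, x_j). -/
theorem covK_row_sum_bounds (n : ℕ) (hn : 1 ≤ n) (ρ : ℝ) (hρ : 0 < ρ)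
    (x : Fin n → ℝ) (hx : ∀ i, x i ∈ Set.Ioo (0 : ℝ) 1)
    (hdist : Function.Injective x) :
    ∀ i : Fin n,
      covK ρ (x i) (x i) + ∑ j ∈ Finset.univ.erase i, |covK ρ (x i) (x j)| ≤
        (Real.sqrt (8 * π * ρ))⁻¹ + ChatConst n x i * Real.sqrt ρ ∧
      (Real.sqrt (8 * π * ρ))⁻¹ - ChatConst n x i * Real.sqrt ρ ≤
        covK ρ (x i) (x i) - ∑ j ∈ Finset.univ.erase i, |covK ρ (x i) (x j)| := by
  intro i
  have hdiag := abs_le.1 (abs_covK_self_sub_le hρ (hx i))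
  have hoff : ∑ j ∈ Finset.univ.erase i, |covK ρ (x i) (x j)| ≤
      ∑ j ∈ Finset.univ.erase i,
        (√(8 / π) / (x j - x i) ^ 2 + √2 * π ^ ((3 : ℝ) / 2) / 6) * √ρ :=
    Finset.sum_le_sum fun j hj =>
      abs_covK_le hρ (hx i) (hx j) (hdist.ne (Finset.ne_of_mem_erase hj))
  rw [← Finset.sum_mul, Finset.sum_add_distrib, Finset.sum_const,
    Finset.card_erase_of_mem (Finset.mem_univ i), Finset.card_univ, Fintype.card_fin,
    nsmul_eq_mul, Nat.cast_sub hn, Nat.cast_one] at hoff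
  rw [ChatConst]
  constructor <;> nlinarith [hdiag.1, hdiag.2, hoff]
end
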